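/- arXiv:2604.23349 — 6 statements merged into one kernel-verified Lean document; each statement's English description precedes it below -/
import Mathlib

section
/- Let 1 ≤ k ≤ n. Then the set Γ̃_k = Γ_{k-1} ∩ {λ ∈ ℝⁿ : σ_k(λ) + σ_{k-1}(λ) > 0} is a convex subset of ℝⁿ, and the operator S_k is elliptic on Γ̃_k: for every λ ∈ Γ̃_k and every index 1 ≤ i ≤ n, the partial derivative ∂S_k/∂λ_i (λ) = σ_{k-1}(λ|i) + σ_{k-2}(λ|i) is strictly positive. -/
open scoped BigOperators
noncomputable section

/-- The `k`-th elementary symmetric function of `lam ∈ ℝⁿ`. -/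
def esymm (n k : ℕ) (lam : Fin n → ℝ) : ℝ :=
  ∑ s ∈ Finset.univ.powersetCard k, ∏ i ∈ s, lam i

/-- `σ_m(λ|i)`: the `m`-th elementary symmetric function of `λ` with the `i`-th entry deleted. -/
def esymmErase (n k : ℕ) (lam : Fin n → ℝ) (i : Fin n) : ℝ :=
  ∑ s ∈ (Finset.univ.erase i).powersetCard k, ∏ j ∈ s, lam j

/-- `σ_m(λ|i)` for integer index `m`, with the convention `σ_m = 0` for `m < 0`. -/
def esymmEraseZ (n : ℕ) (k : ℤ) (lam : Fin n → ℝ) (i : Fin n) : ℝ :=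
  if 0 ≤ k then esymmErase n k.toNat lam i else 0

/-- The Gårding cone `Γ_k` (with `Γ₀ = ℝⁿ`). -/
def GammaCone (n k : ℕ) : Set (Fin n → ℝ) :=
  {lam | ∀ i : ℕ, 1 ≤ i → i ≤ k → 0 < esymm n i lam}

/-- The cone `Γ̃_k = Γ_{k-1} ∩ {S_k = σ_k + σ_{k-1} > 0}`. -/
def GammaTilde (n k : ℕ) : Set (Fin n → ℝ) :=
  GammaCone n (k - 1) ∩ {lam | 0 < esymm n k lam + esymm n (k - 1) lam}

open Polynomial in
/-- By Rolle's theorem, the derivative of a real-rooted polynomial is real-rooted. -/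
theorem splits_derivative_real {p : ℝ[X]} (hp : p.Splits) : (derivative p).Splits := by
  rcases Nat.eq_zero_or_pos p.natDegree with h0 | h0
  · rw [natDegree_eq_zero] at h0
    obtain ⟨c, rfl⟩ := h0
    simp
  · rw [splits_iff_card_roots] at hp ⊢
    have h1 := card_roots_le_derivative p
    have h2 := card_roots' (derivative p)
    have h3 := natDegree_derivative_lt (p := p) h0.ne'
    omega

open Polynomial in
/-- The Laguerre inequality for real-rooted polynomials. -/
theorem laguerre_inequality {p : ℝ[X]} (hp : p.Splits) (x : ℝ) :
    p.eval x * (derivative (derivative p)).eval x ≤ (derivative p).eval x ^ 2 := by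
  obtain ⟨m, hm⟩ := splits_iff_exists_multiset.mp hp
  generalize p.leadingCoeff = c at hm
  subst hm
  clear hp
  induction m using Multiset.induction_on with
  | empty => simp
  | cons a m ih =>
    rw [Multiset.map_cons, Multiset.prod_cons, mul_left_comm]
    generalize C c * (Multiset.map (fun a => X - C a) m).prod = g at ih
    simp only [derivative_mul, derivative_sub, derivative_X, derivative_C, derivative_add,
      derivative_one, derivative_zero, eval_mul, eval_add, eval_sub, eval_X, eval_C, eval_one, eval_zero]
    nlinarith [mul_nonneg (sq_nonneg (x - a)) (sub_nonneg.mpr ih), sq_nonneg (g.eval x)]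

open Polynomial in
/-- The coefficients of a real-rooted polynomial satisfy Newton's inequality in weak form. -/
theorem coeff_mul_coeff_le_sq_of_splits {p : ℝ[X]} (hp : p.Splits) (k : ℕ) :
    p.coeff k * p.coeff (k + 2) ≤ p.coeff (k + 1) ^ 2 := by
  have hs : (derivative^[k] p).Splits := by
    induction k with
    | zero => exact hp
    | succ k ih => rw [Function.iterate_succ_apply']; exact splits_derivative_real ih
  have h := laguerre_inequality hs 0
  simp only [← coeff_zero_eq_eval_zero, ← Function.iterate_succ_apply' derivative,
    coeff_iterate_derivative, zero_add, Nat.descFactorial_self, nsmul_eq_mul] at h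
  rw [Nat.factorial_succ (k + 1), Nat.factorial_succ k] at h
  simp only [Nat.succ_eq_add_one, Nat.add_assoc, Nat.reduceAdd] at h
  push_cast at h
  have hf : (0 : ℝ) < (k.factorial : ℝ) ^ 2 * (k + 1) := by positivity
  have h2 : (k + 2 : ℝ) * (p.coeff k * p.coeff (k + 2)) ≤ (k + 1) * p.coeff (k + 1) ^ 2 := by
    refine le_of_mul_le_mul_left ?_ hf
    ring_nf at h ⊢
    linarith
  have hk : (0 : ℝ) ≤ k := k.cast_nonneg
  by_contra! hc
  nlinarith [sq_nonneg (p.coeff (k + 1))]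

section ElementarySymmetric

variable {ι : Type*}

/-- The `k`-th elementary symmetric function of the entries of `x` indexed by `s`. -/
def esymmOn (s : Finset ι) (k : ℕ) (x : ι → ℝ) : ℝ :=
  ∑ t ∈ s.powersetCard k, ∏ i ∈ t, x i

@[simp]
theorem esymmOn_zero (s : Finset ι) (x : ι → ℝ) : esymmOn s 0 x = 1 := by
  simp [esymmOn]

theorem esymmOn_one (s : Finset ι) (x : ι → ℝ) : esymmOn s 1 x = ∑ i ∈ s, x i := by
  simp [esymmOn, Finset.powersetCard_one]

theorem esymmOn_map {κ : Type*} (f : κ ↪ ι) (s : Finset κ) (k : ℕ) (x : ι → ℝ) :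
    esymmOn (s.map f) k x = esymmOn s k (x ∘ f) := by
  simp [esymmOn, Finset.powersetCard_map]

theorem esymmOn_smul (s : Finset ι) (k : ℕ) (c : ℝ) (x : ι → ℝ) :
    esymmOn s k (c • x) = c ^ k * esymmOn s k x := by
  simp only [esymmOn, Finset.mul_sum]
  refine Finset.sum_congr rfl fun t ht => ?_
  simp [Finset.prod_mul_distrib, (Finset.mem_powersetCard.mp ht).2]

/-- The Gårding cone `Γ_k` for the entries indexed by `s`. -/
def gardingCone (s : Finset ι) (k : ℕ) : Set (ι → ℝ) :=
  {x | ∀ j ≤ k, 0 < esymmOn s j x}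

variable [DecidableEq ι]

theorem esymmOn_insert {s : Finset ι} {a : ι} (ha : a ∉ s) (k : ℕ) (x : ι → ℝ) :
    esymmOn (insert a s) (k + 1) x = esymmOn s (k + 1) x + x a * esymmOn s k x := by
  have hnot : ∀ t ∈ s.powersetCard k, a ∉ t := fun t ht h =>
    ha ((Finset.mem_powersetCard.mp ht).1 h)
  unfold esymmOn
  rw [Finset.powersetCard_succ_insert ha, Finset.sum_union, Finset.sum_image, Finset.mul_sum]
  · congr 1
    exact Finset.sum_congr rfl fun t ht => Finset.prod_insert (hnot t ht)
  · intro t ht u hu htu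
    rw [← Finset.erase_insert (hnot t ht), ← Finset.erase_insert (hnot u hu), htu]
  · rw [Finset.disjoint_left]
    intro t ht ht'
    obtain ⟨u, -, rfl⟩ := Finset.mem_image.mp ht'
    exact ha ((Finset.mem_powersetCard.mp ht).1 (Finset.mem_insert_self a u))

theorem esymmOn_succ_eq_erase {s : Finset ι} {a : ι} (ha : a ∈ s) (k : ℕ) (x : ι → ℝ) :
    esymmOn s (k + 1) x = esymmOn (s.erase a) (k + 1) x + x a * esymmOn (s.erase a) k x := by
  rw [← esymmOn_insert (Finset.notMem_erase a s), Finset.insert_erase ha]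

/-- Euler's identity for the elementary symmetric functions. -/
theorem sum_mul_esymmOn_erase (s : Finset ι) (k : ℕ) (x : ι → ℝ) :
    ∑ i ∈ s, x i * esymmOn (s.erase i) k x = (k + 1) * esymmOn s (k + 1) x := by
  have h : ∀ i ∈ s, x i * esymmOn (s.erase i) k x =
      ∑ t ∈ s.powersetCard (k + 1), if i ∈ t then ∏ j ∈ t, x j else 0 := by
    intro i hi
    have h1 := esymmOn_succ_eq_erase hi k x
    have h2 : (s.erase i).powersetCard (k + 1) =
        (s.powersetCard (k + 1)).filter fun t => i ∉ t := by
      ext t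
      simp only [Finset.mem_powersetCard, Finset.mem_filter, Finset.subset_erase]
      tauto
    have h3 := Finset.sum_filter_add_sum_filter_not (s.powersetCard (k + 1))
      (fun t => i ∈ t) fun t => ∏ j ∈ t, x j
    rw [← h2] at h3
    rw [← Finset.sum_filter]
    simp only [esymmOn] at h1 ⊢
    linarith
  rw [Finset.sum_congr rfl h, Finset.sum_comm, esymmOn, Finset.mul_sum]
  refine Finset.sum_congr rfl fun t ht => ?_
  obtain ⟨hts, hcard⟩ := Finset.mem_powersetCard.mp ht
  rw [← Finset.sum_filter, Finset.filter_mem_eq_inter, Finset.inter_eq_right.mpr hts]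
  simp [hcard]

open Polynomial in
theorem coeff_prod_one_add_C_mul_X (s : Finset ι) (k : ℕ) (x : ι → ℝ) :
    (∏ i ∈ s, (C (x i) * X + C 1)).coeff k = esymmOn s k x := by
  induction s using Finset.induction_on generalizing k with
  | empty =>
    cases k with
    | zero => simp
    | succ k =>
      rw [esymmOn, Finset.powersetCard_eq_empty.mpr (by simp)]
      simp [coeff_one]
  | insert a s ha ih =>
    rw [Finset.prod_insert ha]
    cases k with
    | zero => rw [mul_coeff_zero, ih]; simp
    | succ k =>
      rw [esymmOn_insert ha, add_mul, mul_assoc, coeff_add, coeff_C_mul, coeff_X_mul, ih,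
        coeff_C_mul, ih]
      ring

/-- The Newton inequality in weak form. -/
theorem esymmOn_mul_esymmOn_le_sq (s : Finset ι) (k : ℕ) (x : ι → ℝ) :
    esymmOn s k x * esymmOn s (k + 2) x ≤ esymmOn s (k + 1) x ^ 2 := by
  simp only [← coeff_prod_one_add_C_mul_X]
  refine coeff_mul_coeff_le_sq_of_splits (Polynomial.Splits.prod fun i _ => ?_) k
  exact Polynomial.Splits.of_natDegree_le_one Polynomial.natDegree_linear_le

/-- Deleting an entry maps `Γ_{k+1}` into `Γ_k`. -/
theorem gardingCone_erase {s : Finset ι} {a : ι} (ha : a ∈ s) {k : ℕ} {x : ι → ℝ}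
    (hx : x ∈ gardingCone s (k + 1)) : x ∈ gardingCone (s.erase a) k := by
  intro j
  induction j with
  | zero => simp
  | succ j ih =>
    intro hj
    have h0 := ih (by omega)
    have h1 := hx (j + 1) (by omega)
    have h2 := hx (j + 2) (by omega)
    rw [esymmOn_succ_eq_erase ha] at h1 h2
    have hN := esymmOn_mul_esymmOn_le_sq (s.erase a) j x
    by_contra! hc
    nlinarith [mul_pos h0 h2, mul_nonneg (neg_nonneg.mpr hc) h1.le]

/-- A recursion for the quotient of two consecutive elementary symmetric functions. -/
theorem mul_esymmOn_div_esymmOn {s : Finset ι} {k : ℕ} {x : ι → ℝ}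
    (hx : x ∈ gardingCone s (k + 1)) :
    (k + 2) * (esymmOn s (k + 2) x / esymmOn s (k + 1) x) =
      ∑ i ∈ s, (x i - x i ^ 2 /
        (x i + esymmOn (s.erase i) (k + 1) x / esymmOn (s.erase i) k x)) := by
  have hE := hx (k + 1) le_rfl
  have h := sum_mul_esymmOn_erase s (k + 1) x
  push_cast at h
  rw [mul_div_assoc', div_eq_iff hE.ne', Finset.sum_mul,
    show (k + 2 : ℝ) = k + 1 + 1 by ring, ← h]
  refine Finset.sum_congr rfl fun i hi => ?_
  have h0 := gardingCone_erase hi hx k le_rfl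
  have h1 := esymmOn_succ_eq_erase hi k x
  have h2 : x i + esymmOn (s.erase i) (k + 1) x / esymmOn (s.erase i) k x =
      esymmOn s (k + 1) x / esymmOn (s.erase i) k x := by
    rw [h1]; field_simp; ring
  rw [h2]
  field_simp
  rw [h1]
  ring

theorem add_sq_div_le {a b c x y : ℝ} (ha : 0 < a) (hb : 0 < b) (hc : a + b ≤ c) :
    (x + y) ^ 2 / c ≤ x ^ 2 / a + y ^ 2 / b := by
  refine (div_le_div_of_nonneg_left (sq_nonneg _) (add_pos ha hb) hc).trans ?_
  rw [div_add_div _ _ ha.ne' hb.ne', div_le_div_iff₀ (add_pos ha hb) (mul_pos ha hb)]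
  have : 0 ≤ (x * b - y * a) ^ 2 := sq_nonneg _
  nlinarith

/-- The Marcus–Lopes inequality: `Γ_k` is closed under addition and `σ_{k+1} / σ_k` is
superadditive on it. -/
theorem gardingCone_add_and_superadditive (k : ℕ) (s : Finset ι) {x y : ι → ℝ}
    (hx : x ∈ gardingCone s k) (hy : y ∈ gardingCone s k) :
    x + y ∈ gardingCone s k ∧
      esymmOn s (k + 1) x / esymmOn s k x + esymmOn s (k + 1) y / esymmOn s k y ≤
        esymmOn s (k + 1) (x + y) / esymmOn s k (x + y) := by
  induction k generalizing s with
  | zero =>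
    constructor
    · intro j hj
      obtain rfl : j = 0 := by omega
      simp
    · simp [esymmOn_one, Finset.sum_add_distrib]
  | succ k ih =>
    have hxy : x + y ∈ gardingCone s (k + 1) := by
      obtain ⟨h1, h2⟩ := ih s (fun j hj => hx j (by omega)) (fun j hj => hy j (by omega))
      intro j hj
      rcases Nat.lt_or_ge j (k + 1) with hlt | hge
      · exact h1 j (by omega)
      · obtain rfl : j = k + 1 := by omega
        have hqx := div_pos (hx (k + 1) le_rfl) (hx k (by omega))
        have hqy := div_pos (hy (k + 1) le_rfl) (hy k (by omega))
        exact (div_pos_iff_of_pos_right (h1 k le_rfl)).mp (by linarith)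
    refine ⟨hxy, ?_⟩
    have hk : (0 : ℝ) < k + 2 := by positivity
    refine le_of_mul_le_mul_left ?_ hk
    rw [mul_add]
    simp only [add_assoc, Nat.reduceAdd]
    rw [mul_esymmOn_div_esymmOn hx, mul_esymmOn_div_esymmOn hy, mul_esymmOn_div_esymmOn hxy,
      ← Finset.sum_add_distrib]
    refine Finset.sum_le_sum fun i hi => ?_
    have hpos : ∀ z ∈ gardingCone s (k + 1),
        0 < z i + esymmOn (s.erase i) (k + 1) z / esymmOn (s.erase i) k z := by
      intro z hz
      have h0 := gardingCone_erase hi hz k le_rfl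
      have h1 := hz (k + 1) le_rfl
      rw [esymmOn_succ_eq_erase hi] at h1
      have h2 := div_pos h1 h0
      rwa [add_div, mul_div_cancel_right₀ _ h0.ne', add_comm] at h2
    have hq := (ih (s.erase i) (gardingCone_erase hi hx) (gardingCone_erase hi hy)).2
    have := add_sq_div_le (x := x i) (y := y i) (hpos x hx) (hpos y hy)
      (c := (x + y) i + esymmOn (s.erase i) (k + 1) (x + y) / esymmOn (s.erase i) k (x + y))
      (by rw [Pi.add_apply]; linarith)
    rw [Pi.add_apply] at this ⊢
    linarith

theorem convex_gardingCone (s : Finset ι) (k : ℕ) : Convex ℝ (gardingCone s k) := by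
  have hsmul : ∀ c : ℝ, 0 < c → ∀ x ∈ gardingCone s k, c • x ∈ gardingCone s k := by
    intro c hc x hx j hj
    rw [esymmOn_smul]
    exact mul_pos (pow_pos hc j) (hx j hj)
  rw [convex_iff_forall_pos]
  intro x hx y hy a b ha hb _
  exact (gardingCone_add_and_superadditive k s (hsmul a ha x hx) (hsmul b hb y hy)).1

end ElementarySymmetric

/-- The vector `lam` with one more entry equal to `1`. -/
def appendOne {n : ℕ} (lam : Fin n → ℝ) : Option (Fin n) → ℝ :=
  fun o => o.elim 1 lam

theorem esymmOn_map_some_appendOne {n : ℕ} (s : Finset (Fin n)) (k : ℕ) (lam : Fin n → ℝ) :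
    esymmOn (s.map Function.Embedding.some) k (appendOne lam) = esymmOn s k lam := by
  rw [esymmOn_map]
  rfl

theorem esymmOn_insertNone_appendOne {n : ℕ} (s : Finset (Fin n)) (k : ℕ) (lam : Fin n → ℝ) :
    esymmOn (insert none (s.map Function.Embedding.some)) (k + 1) (appendOne lam) =
      esymmOn s (k + 1) lam + esymmOn s k lam := by
  rw [esymmOn_insert (by simp), esymmOn_map_some_appendOne, esymmOn_map_some_appendOne]
  simp [appendOne]

theorem univ_option_eq_insert {n : ℕ} :
    (Finset.univ : Finset (Option (Fin n))) =
      insert none (Finset.univ.map Function.Embedding.some) := by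
  ext o
  cases o <;> simp

/-- `Γ̃_{k+1}` is the slice of the Gårding cone `Γ_{k+1}` in one more variable where that
variable equals `1`. -/
theorem mem_gammaTilde_succ_iff {n k : ℕ} {lam : Fin n → ℝ} :
    lam ∈ GammaTilde n (k + 1) ↔ appendOne lam ∈ gardingCone Finset.univ (k + 1) := by
  constructor
  · rintro ⟨h1, h2⟩ j hj
    have hpos : ∀ i ≤ k, 0 < esymmOn Finset.univ i lam := by
      intro i hi
      rcases Nat.eq_zero_or_pos i with rfl | h0
      · simp
      · exact h1 i h0 (by simpa using hi)
    cases j with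
    | zero => simp
    | succ j =>
      rw [univ_option_eq_insert, esymmOn_insertNone_appendOne]
      rcases Nat.lt_or_ge j k with hlt | hge
      · exact add_pos (hpos _ hlt) (hpos _ hlt.le)
      · obtain rfl : j = k := by omega
        exact h2
  · intro h
    have h1 := gardingCone_erase (Finset.mem_univ none) h
    rw [univ_option_eq_insert, Finset.erase_insert (by simp)] at h1
    refine ⟨fun i _ hi => ?_, ?_⟩
    · have := h1 i (by simpa using hi)
      rwa [esymmOn_map_some_appendOne] at this
    · have := h (k + 1) le_rfl
      rwa [univ_option_eq_insert, esymmOn_insertNone_appendOne] at this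

/-- `Γ̃_k` is convex and the sum Hessian operator `S_k` is elliptic on `Γ̃_k`:
each partial derivative `∂S_k/∂λ_i = σ_{k-1}(λ|i) + σ_{k-2}(λ|i)` is strictly positive. -/
theorem gammaTilde_convex_and_Sk_elliptic (n k : ℕ) (hk : 1 ≤ k) (hkn : k ≤ n) :
    Convex ℝ (GammaTilde n k) ∧
    ∀ lam ∈ GammaTilde n k, ∀ i : Fin n,
      0 < esymmEraseZ n ((k : ℤ) - 1) lam i + esymmEraseZ n ((k : ℤ) - 2) lam i := by
  obtain ⟨k, rfl⟩ : ∃ m, k = m + 1 := ⟨k - 1, by omega⟩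
  constructor
  · intro x hx y hy a b ha hb hab
    rw [mem_gammaTilde_succ_iff] at hx hy ⊢
    convert convex_gardingCone _ _ hx hy ha hb hab using 1
    funext o
    cases o <;> simp [appendOne, hab]
  · intro lam hlam i
    rw [mem_gammaTilde_succ_iff] at hlam
    have h := gardingCone_erase (Finset.mem_univ (some i)) hlam k le_rfl
    have herase : (Finset.univ : Finset (Option (Fin n))).erase (some i) =
        insert none ((Finset.univ.erase i).map Function.Embedding.some) := by
      ext o
      cases o <;> simp
    rw [herase] at h
    cases k with
    | zero => simp [esymmEraseZ, esymmErase]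
    | succ k =>
      rw [esymmOn_insertNone_appendOne] at h
      rw [show ((k + 1 + 1 : ℕ) : ℤ) - 1 = ((k + 1 : ℕ) : ℤ) by push_cast; ring,
        show ((k + 1 + 1 : ℕ) : ℤ) - 2 = (k : ℤ) by push_cast; ring,
        esymmEraseZ, esymmEraseZ, if_pos (Int.natCast_nonneg _), if_pos (Int.natCast_nonneg _),
        Int.toNat_natCast, Int.toNat_natCast]
      exact h
end
end

section
/- Let 2 ≤ k ≤ n. There exists a constant c₁ > 0, depending only on n and k, such that for every λ ∈ Γ̃_k with λ₁ ≥ λ₂ ≥ ⋯ ≥ λ_n and every 1 ≤ j ≤ k-1, one has λ_j > 0 and ∂S_k/∂λ_j (λ) = σ_{k-1}(λ|j) + σ_{k-2}(λ|j) ≥ c₁ · S_k(λ)/λ_j. -/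
open scoped BigOperators
noncomputable section

namespace Polynomial

theorem Splits.derivative_real {p : ℝ[X]} (hp : p.Splits) : p.derivative.Splits := by
  rw [splits_iff_card_roots] at hp ⊢
  have h1 := card_roots_le_derivative p
  have h2 := natDegree_derivative_le p
  have h3 := card_roots' (derivative p)
  omega

/-- The Laguerre inequality for a real polynomial with only real roots. -/
theorem Splits.eval_mul_eval_derivative_derivative_le {p : ℝ[X]} (hp : p.Splits) (x : ℝ) :
    p.eval x * p.derivative.derivative.eval x ≤ p.derivative.eval x ^ 2 := by
  obtain ⟨s, hs⟩ := splits_iff_exists_multiset.mp hp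
  rw [hs]
  generalize p.leadingCoeff = c
  clear hs hp p
  induction s using Multiset.induction_on with
  | empty => simp
  | cons a s ih =>
    rw [Multiset.map_cons, Multiset.prod_cons, mul_left_comm]
    generalize C c * (s.map fun a => X - C a).prod = q at ih ⊢
    simp only [derivative_mul, derivative_sub, derivative_X, derivative_C, derivative_add,
      eval_mul, eval_add, eval_sub, eval_X, eval_C, sub_zero, one_mul]
    nlinarith [mul_le_mul_of_nonneg_left ih (sq_nonneg (x - a)), sq_nonneg (q.eval x)]

theorem Splits.coeff_mul_coeff_add_two_le {p : ℝ[X]} (hp : p.Splits) (i : ℕ) :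
    (i + 2) * (p.coeff i * p.coeff (i + 2)) ≤ (i + 1) * p.coeff (i + 1) ^ 2 := by
  induction i generalizing p with
  | zero =>
    have h := hp.eval_mul_eval_derivative_derivative_le 0
    simp only [← coeff_zero_eq_eval_zero, coeff_derivative] at h
    norm_num at h ⊢
    linarith
  | succ i ih =>
    have h := ih hp.derivative_real
    simp only [coeff_derivative] at h
    push_cast at h ⊢
    have hpos : (0 : ℝ) < (i + 1) * (i + 2) := by positivity
    refine le_of_mul_le_mul_left ?_ hpos
    linarith

end Polynomial

namespace Multiset

theorem esymm_zero_right {R : Type*} [CommSemiring R] (s : Multiset R) : s.esymm 0 = 1 := by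
  simp [esymm]

theorem esymm_cons_succ {R : Type*} [CommSemiring R] (a : R) (s : Multiset R) (k : ℕ) :
    (a ::ₘ s).esymm (k + 1) = s.esymm (k + 1) + a * s.esymm k := by
  simp [esymm, Multiset.sum_map_mul_left]

theorem esymm_eq_zero_of_card_lt {R : Type*} [CommSemiring R] {s : Multiset R} {k : ℕ}
    (h : card s < k) : s.esymm k = 0 := by
  simp [esymm, powersetCard_eq_empty k h]

theorem esymm_nonneg {s : Multiset ℝ} (hs : ∀ x ∈ s, 0 ≤ x) (k : ℕ) : 0 ≤ s.esymm k := by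
  refine sum_nonneg fun y hy => ?_
  obtain ⟨t, ht, rfl⟩ := mem_map.mp hy
  exact prod_nonneg fun x hx => hs x (mem_of_le (mem_powersetCard.mp ht).1 hx)

/-- A weak form of Newton's inequality, valid for all real entries. -/
theorem esymm_mul_esymm_add_two_le (s : Multiset ℝ) (k : ℕ) :
    s.esymm k * s.esymm (k + 2) ≤ s.esymm (k + 1) ^ 2 := by
  rcases lt_or_ge (card s) (k + 2) with h | h
  · rw [esymm_eq_zero_of_card_lt h, mul_zero]
    positivity
  obtain ⟨i, hi⟩ := Nat.exists_eq_add_of_le h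
  have hsplit : (s.map fun r => Polynomial.X + Polynomial.C r).prod.Splits := by
    refine Polynomial.Splits.multisetProd fun f hf => ?_
    obtain ⟨r, -, rfl⟩ := mem_map.mp hf
    exact Polynomial.Splits.X_add_C r
  have hN := hsplit.coeff_mul_coeff_add_two_le i
  rw [prod_X_add_C_coeff s (by omega), prod_X_add_C_coeff s (by omega),
    prod_X_add_C_coeff s (by omega), show card s - i = k + 2 by omega,
    show card s - (i + 2) = k by omega, show card s - (i + 1) = k + 1 by omega] at hN
  have hi0 : (0 : ℝ) ≤ i := i.cast_nonneg
  by_contra! hlt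
  nlinarith [sq_nonneg (s.esymm (k + 1))]

/-- Membership of the entries of `s` in the Gårding cone `Γ_k`. -/
def InGarding (s : Multiset ℝ) (k : ℕ) : Prop := ∀ i ≤ k, 0 < s.esymm i

theorem InGarding.mono {s : Multiset ℝ} {k l : ℕ} (h : s.InGarding k) (hl : l ≤ k) :
    s.InGarding l := fun i hi => h i (hi.trans hl)

theorem InGarding.of_cons {a : ℝ} {s : Multiset ℝ} {k : ℕ} (h : (a ::ₘ s).InGarding (k + 1)) :
    s.InGarding k := by
  intro i
  induction i with
  | zero => simp [esymm_zero_right]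
  | succ i ih =>
    intro hi
    have h0 := ih (by omega)
    have h1 := h (i + 1) (by omega)
    have h2 := h (i + 2) (by omega)
    rw [esymm_cons_succ] at h1 h2
    have hN := esymm_mul_esymm_add_two_le s i
    by_contra! hneg
    nlinarith [mul_pos h0 h2, mul_nonneg (neg_nonneg.mpr hneg) h1.le]

theorem InGarding.of_add {p q : Multiset ℝ} {k : ℕ} (h : (p + q).InGarding (card p + k)) :
    q.InGarding k := by
  induction p using Multiset.induction_on with
  | empty => simpa using h
  | cons a p ih =>
    refine ih (InGarding.of_cons (a := a) ?_)
    rw [cons_add, card_cons] at h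
    exact h.mono (by omega)

theorem InGarding.cons_of_le {a b : ℝ} {s : Multiset ℝ} {k : ℕ} (h : (a ::ₘ s).InGarding k)
    (hab : a ≤ b) : (b ::ₘ s).InGarding k := by
  rintro (_ | i) hi
  · simp [esymm_zero_right]
  · have h1 := h (i + 1) hi
    have h2 := (h.mono hi).of_cons i le_rfl
    rw [esymm_cons_succ] at h1 ⊢
    nlinarith

theorem InGarding.add_replicate {s q : Multiset ℝ} {t : ℝ} {k : ℕ} (h : (s + q).InGarding k)
    (hq : ∀ x ∈ q, x ≤ t) : (s + replicate (card q) t).InGarding k := by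
  induction q using Multiset.induction_on generalizing s with
  | empty => simpa using h
  | cons a q ih =>
    rw [add_cons] at h
    rw [card_cons, replicate_succ, add_cons, ← cons_add]
    refine ih ?_ fun x hx => hq x (mem_cons_of_mem hx)
    rw [cons_add]
    exact h.cons_of_le (hq a (mem_cons_self a q))

theorem esymm_cons_mul_esymm_cons_le {a b : ℝ} (s : Multiset ℝ) (k : ℕ) (hab : a ≤ b) :
    (a ::ₘ s).esymm (k + 2) * (b ::ₘ s).esymm (k + 1) ≤
      (b ::ₘ s).esymm (k + 2) * (a ::ₘ s).esymm (k + 1) := by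
  simp only [esymm_cons_succ]
  nlinarith [mul_le_mul_of_nonneg_left (esymm_mul_esymm_add_two_le s k) (sub_nonneg.mpr hab)]

theorem InGarding.esymm_mul_esymm_add_replicate_le {s q : Multiset ℝ} {t : ℝ} {k : ℕ}
    (h : (s + q).InGarding (k + 1)) (hq : ∀ x ∈ q, x ≤ t) :
    (s + q).esymm (k + 2) * (s + replicate (card q) t).esymm (k + 1) ≤
      (s + replicate (card q) t).esymm (k + 2) * (s + q).esymm (k + 1) := by
  induction q using Multiset.induction_on generalizing s with
  | empty => simp
  | cons a q ih =>
    rw [add_cons] at h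
    have hat := hq a (mem_cons_self a q)
    have hq' : ∀ x ∈ q, x ≤ t := fun x hx => hq x (mem_cons_of_mem hx)
    have hb : ((t ::ₘ s) + q).InGarding (k + 1) := by
      rw [cons_add]
      exact h.cons_of_le hat
    have h1 := esymm_cons_mul_esymm_cons_le (s + q) k hat
    have h2 := ih hb hq'
    have hP := (hb.add_replicate hq') (k + 1) le_rfl
    have hA := h (k + 1) le_rfl
    have hB := hb (k + 1) le_rfl
    rw [card_cons, replicate_succ, add_cons, add_cons, ← cons_add t]
    rw [← cons_add t] at h1
    refine le_of_mul_le_mul_right ?_ hB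
    linarith [mul_le_mul_of_nonneg_right h1 hP.le, mul_le_mul_of_nonneg_right h2 hA.le]

theorem esymm_succ_add_replicate_le {p : Multiset ℝ} {t : ℝ} {k : ℕ} (hp : ∀ x ∈ p, 0 ≤ x)
    (ht : 0 ≤ t) (hk : card p ≤ k) (m : ℕ) :
    (p + replicate m t).esymm (k + 1) ≤ m * t * (p + replicate m t).esymm k := by
  induction m with
  | zero => simp [esymm_eq_zero_of_card_lt (Nat.lt_succ_of_le hk)]
  | succ m ih =>
    have hnn : ∀ x ∈ p + replicate m t, 0 ≤ x := by
      intro x hx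
      rcases mem_add.mp hx with hx | hx
      · exact hp x hx
      · rwa [eq_of_mem_replicate hx]
    have hle : (p + replicate m t).esymm k ≤ (t ::ₘ (p + replicate m t)).esymm k := by
      cases k with
      | zero => simp [esymm_zero_right]
      | succ k =>
        rw [esymm_cons_succ]
        exact le_add_of_nonneg_right (mul_nonneg ht (esymm_nonneg hnn k))
    rw [replicate_succ, add_cons, esymm_cons_succ]
    push_cast
    have hm : (0 : ℝ) ≤ (m + 1) * t := by positivity
    linarith [mul_le_mul_of_nonneg_left hle hm]

/-- If at most `k + 1` entries, all nonnegative, are singled out, then in the Gårding cone `Γ_{k+1}`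
the quotient `σ_{k+2} / σ_{k+1}` is controlled by any nonnegative bound on the other entries. -/
theorem InGarding.esymm_succ_le {p q : Multiset ℝ} {t : ℝ} {k : ℕ}
    (h : (p + q).InGarding (k + 1)) (hp : ∀ x ∈ p, 0 ≤ x) (hq : ∀ x ∈ q, x ≤ t) (ht : 0 ≤ t)
    (hk : card p ≤ k + 1) :
    (p + q).esymm (k + 2) ≤ card q * t * (p + q).esymm (k + 1) := by
  have h1 := h.esymm_mul_esymm_add_replicate_le hq
  have h2 := esymm_succ_add_replicate_le hp ht hk (card q)
  refine le_of_mul_le_mul_right ?_ (h.add_replicate hq (k + 1) le_rfl)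
  linarith [mul_le_mul_of_nonneg_right h2 (h (k + 1) le_rfl).le]

end Multiset

/-- For `λ ∈ Γ̃_k` ordered decreasingly and `1 ≤ j ≤ k-1` (one-indexed, i.e. the Fin index `j`
satisfies `j+1 < k`), one has `λ_j > 0` and `∂S_k/∂λ_j ≥ c₁ S_k(λ)/λ_j`. -/
theorem Sk_derivative_lower_bound_small_index (n k : ℕ) (hk : 2 ≤ k) (hkn : k ≤ n) :
    ∃ c₁ : ℝ, 0 < c₁ ∧
      ∀ lam ∈ GammaTilde n k, Antitone lam →
        ∀ j : Fin n, (j : ℕ) + 1 < k →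
          0 < lam j ∧
          c₁ * (esymm n k lam + esymm n (k - 1) lam) / lam j ≤
            esymmErase n (k - 1) lam j + esymmErase n (k - 2) lam j := by
  obtain ⟨k, rfl⟩ := Nat.exists_eq_add_of_le' hk
  refine ⟨1 / (n + 1), by positivity, ?_⟩
  rintro lam ⟨hcone, hS⟩ hanti j hj
  simp only [GammaCone, Set.mem_ofPred_eq, Nat.add_sub_cancel,
    show k + 2 - 1 = k + 1 by omega] at hcone hS ⊢
  have hE : ∀ m, esymm n m lam = (Finset.univ.val.map lam).esymm m := fun m =>
    (Finset.esymm_map_val lam _ m).symm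
  have hE' : ∀ m, esymmErase n m lam j = ((Finset.univ.erase j).val.map lam).esymm m := fun m =>
    (Finset.esymm_map_val lam _ m).symm
  set p : Multiset ℝ := 1 ::ₘ (Finset.Iio j).val.map lam with hp
  set q : Multiset ℝ := (Finset.Ioi j).val.map lam with hq
  have hsplit : 1 ::ₘ (Finset.univ.erase j).val.map lam = p + q := by
    have hval : (Finset.univ.erase j).val = (Finset.Iio j).val + (Finset.Ioi j).val := by
      have hd : Disjoint (Finset.Iio j) (Finset.Ioi j) := by
        rw [Finset.disjoint_left]
        intro x hx hx'
        exact lt_asymm (Finset.mem_Iio.mp hx) (Finset.mem_Ioi.mp hx')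
      rw [← Finset.disjUnion_val _ _ hd]
      congr 1
      ext x
      simp [lt_or_lt_iff_ne]
    rw [hval, Multiset.map_add, hp, hq, Multiset.cons_add]
  have hall : 1 ::ₘ Finset.univ.val.map lam = lam j ::ₘ (p + q) := by
    rw [← hsplit, Multiset.cons_swap, ← Multiset.map_cons, ← Finset.insert_val_of_notMem (by simp),
      Finset.insert_erase (Finset.mem_univ j)]
  have hG : (lam j ::ₘ (p + q)).InGarding (k + 2) := by
    rw [← hall]
    rintro (_ | i) hi
    · simp [Multiset.esymm_zero_right]
    rw [Multiset.esymm_cons_succ, one_mul, ← hE, ← hE]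
    rcases Nat.lt_or_ge i (k + 1) with hik | hik
    · have h1 := hcone (i + 1) (by omega) (by omega)
      rcases Nat.eq_zero_or_pos i with rfl | hi0
      · have : esymm n 0 lam = 1 := by rw [hE, Multiset.esymm_zero_right]
        linarith
      · linarith [hcone i hi0 hik.le]
    · obtain rfl : i = k + 1 := by omega
      exact hS
  have hcp : Multiset.card p = j + 1 := by simp [hp]
  have hqle : ∀ x ∈ q, x ≤ lam j := by
    intro x hx
    obtain ⟨i, hi, rfl⟩ := Multiset.mem_map.mp hx
    exact hanti (Finset.mem_Ioi.mp hi).le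
  have hpos : 0 < lam j := by
    have hG1 : (lam j ::ₘ q).InGarding 1 := by
      refine Multiset.InGarding.of_add (p := p) ?_
      rw [Multiset.add_cons, hcp]
      exact hG.mono (by omega)
    have hsum := hG1 1 le_rfl
    by_contra! hneg
    have : (lam j ::ₘ q).sum ≤ 0 := by
      rw [Multiset.sum_cons]
      have : q.sum ≤ Multiset.card q • (0 : ℝ) :=
        Multiset.sum_le_card_nsmul q 0 fun x hx => (hqle x hx).trans hneg
      simp only [smul_zero] at this
      linarith
    simp only [Multiset.esymm, Multiset.powersetCard_one, Multiset.map_map, Function.comp_def,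
      Multiset.prod_singleton, Multiset.map_id'] at hsum
    linarith
  refine ⟨hpos, ?_⟩
  have hp0 : ∀ x ∈ p, 0 ≤ x := by
    intro x hx
    rcases Multiset.mem_cons.mp hx with rfl | hx
    · exact zero_le_one
    · obtain ⟨i, hi, rfl⟩ := Multiset.mem_map.mp hx
      exact hpos.le.trans (hanti (Finset.mem_Iio.mp hi).le)
  have hν := hG.of_cons
  have hmain := hν.esymm_succ_le hp0 hqle hpos.le (by omega)
  have hνpos := hν (k + 1) le_rfl
  have hcq : (Multiset.card q : ℝ) ≤ n := by
    have : Multiset.card q ≤ n := by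
      simp only [hq, Multiset.card_map, Finset.card_val, Fin.card_Ioi]
      omega
    exact_mod_cast this
  have hleft : esymm n (k + 2) lam + esymm n (k + 1) lam =
      (p + q).esymm (k + 2) + lam j * (p + q).esymm (k + 1) := by
    rw [← Multiset.esymm_cons_succ, ← hall, Multiset.esymm_cons_succ, one_mul, hE, hE]
  have hright : esymmErase n (k + 1) lam j + esymmErase n k lam j = (p + q).esymm (k + 1) := by
    rw [← hsplit, Multiset.esymm_cons_succ, one_mul, hE', hE']
  rw [hleft, hright, div_le_iff₀ hpos, one_div, inv_mul_le_iff₀ (by positivity)]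
  have := mul_le_mul_of_nonneg_right hcq (mul_pos hpos hνpos).le
  linarith
end
end

section
/- Let 1 ≤ k ≤ n, N₁ > 0 and K > 0. There exists a constant C₃ > 0, depending only on N₁, n, k and K, such that for every λ ∈ Γ̃_k with λ₁ ≥ λ₂ ≥ ⋯ ≥ λ_n, if S_k(λ) ≤ N₁ and λ_i ≥ -K for all 1 ≤ i ≤ n, then |λ_i| ≤ C₃ for all i ≥ k. -/
open scoped BigOperators
noncomputable section

/-- If a finite set `t` collects indices where `f ≥ a`, and `f ≤ a` off `t`, then `t` maximizes the
product of `f` among the finite sets of the same cardinality. -/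
theorem prod_le_prod_of_card_eq_of_threshold {ι : Type*} [DecidableEq ι] {f : ι → ℝ} {a : ℝ}
    {s t : Finset ι} (hst : s.card = t.card) (ha : 0 ≤ a) (hf : ∀ i, 0 ≤ f i)
    (ht : ∀ i ∈ t, a ≤ f i) (hs : ∀ i, i ∉ t → f i ≤ a) :
    ∏ i ∈ s, f i ≤ ∏ i ∈ t, f i := by
  have h₁ : ∏ i ∈ s \ t, f i ≤ a ^ (s \ t).card := by
    rw [← Finset.prod_const]
    exact Finset.prod_le_prod (fun i _ => hf i) fun i hi => hs i (Finset.mem_sdiff.1 hi).2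
  have h₂ : a ^ (t \ s).card ≤ ∏ i ∈ t \ s, f i := by
    rw [← Finset.prod_const]
    exact Finset.prod_le_prod (fun _ _ => ha) fun i hi => ht i (Finset.mem_sdiff.1 hi).1
  rw [← Finset.prod_inter_mul_prod_sdiff s t, ← Finset.prod_inter_mul_prod_sdiff t s,
    Finset.inter_comm t s]
  refine mul_le_mul_of_nonneg_left (h₁.trans ?_) (Finset.prod_nonneg fun i _ => hf i)
  rwa [Finset.card_sdiff_comm hst]

/-- If all entries are at least `-K`, the largest entries are positive and dominate, in absolute
value, the remaining ones and `K`, then every product of entries is bounded below by `-K` times the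
product of the entries above a threshold entry. -/
theorem neg_mul_prod_Iio_le_prod {n : ℕ} {lam : Fin n → ℝ} {K : ℝ} (hK : 0 < K)
    (hlam : Antitone lam) (hlow : ∀ i, -K ≤ lam i) (p : Fin n) (hp : K ≤ lam p)
    {s : Finset (Fin n)} (hs : s.card = p + 1) :
    -(K * ∏ i ∈ Finset.Iio p, lam i) ≤ ∏ i ∈ s, lam i := by
  have hpos : ∀ i ∈ Finset.Iio p, lam p ≤ lam i := fun i hi =>
    hlam (Finset.mem_Iio.1 hi).le
  have hP : 0 ≤ ∏ i ∈ Finset.Iio p, lam i :=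
    Finset.prod_nonneg fun i hi => by linarith [hpos i hi]
  by_cases hneg : ∀ i ∈ s, 0 ≤ lam i
  · linarith [Finset.prod_nonneg hneg, mul_nonneg hK.le hP]
  push Not at hneg
  obtain ⟨j, hj, hj0⟩ := hneg
  have hcard : (s.erase j).card = (Finset.Iio p).card := by
    rw [Finset.card_erase_of_mem hj, hs, Fin.card_Iio, Nat.add_sub_cancel]
  have hle : ∏ i ∈ s.erase j, |lam i| ≤ ∏ i ∈ Finset.Iio p, |lam i| := by
    refine prod_le_prod_of_card_eq_of_threshold (a := lam p) hcard (by linarith)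
      (fun i => abs_nonneg _) (fun i hi => (hpos i hi).trans (le_abs_self _)) fun i hi => ?_
    rw [Finset.mem_Iio, not_lt] at hi
    exact abs_le.2 ⟨by linarith [hlow i], hlam hi⟩
  have habs : ∏ i ∈ Finset.Iio p, |lam i| = ∏ i ∈ Finset.Iio p, lam i :=
    Finset.prod_congr rfl fun i hi => abs_of_nonneg (by linarith [hpos i hi])
  have hjK : |lam j| ≤ K := abs_le.2 ⟨hlow j, by linarith⟩
  have key : |∏ i ∈ s, lam i| ≤ K * ∏ i ∈ Finset.Iio p, lam i := by
    rw [Finset.abs_prod, ← Finset.mul_prod_erase s _ hj, ← habs]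
    exact mul_le_mul hjK hle (Finset.prod_nonneg fun i _ => abs_nonneg _) hK.le
  exact (abs_le.1 key).1

/-- Lower bound for `σ_{p+1}` by the product of the entries above the threshold entry `lam p`. -/
theorem sub_mul_prod_Iio_le_esymm {n : ℕ} {lam : Fin n → ℝ} {K : ℝ} (hK : 0 < K)
    (hlam : Antitone lam) (hlow : ∀ i, -K ≤ lam i) (p : Fin n) (hp : K ≤ lam p) :
    (lam p - 2 ^ n * K) * ∏ i ∈ Finset.Iio p, lam i ≤ esymm n (p + 1) lam := by
  set P := ∏ i ∈ Finset.Iio p, lam i with hPdef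
  have hP : 0 ≤ P := Finset.prod_nonneg fun i hi => by
    linarith [hlam (Finset.mem_Iio.1 hi).le]
  set A := (Finset.univ : Finset (Fin n)).powersetCard (p + 1)
  have hmem : Finset.Iic p ∈ A :=
    Finset.mem_powersetCard.2 ⟨Finset.subset_univ _, Fin.card_Iic p⟩
  have htop : ∏ i ∈ Finset.Iic p, lam i = lam p * P := by
    rw [← Finset.Iio_insert, Finset.prod_insert (by simp)]
  have hrest : ((A.erase (Finset.Iic p)).card : ℝ) * -(K * P) ≤
      ∑ s ∈ A.erase (Finset.Iic p), ∏ i ∈ s, lam i := by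
    rw [← nsmul_eq_mul]
    exact Finset.card_nsmul_le_sum _ _ _ fun s hs => neg_mul_prod_Iio_le_prod hK hlam hlow p hp
      (Finset.mem_powersetCard.1 (Finset.mem_of_mem_erase hs)).2
  have hcard : ((A.erase (Finset.Iic p)).card : ℝ) ≤ 2 ^ n := by
    have h : (A.erase (Finset.Iic p)).card ≤ 2 ^ n := by
      simpa using Finset.card_le_univ (A.erase (Finset.Iic p))
    exact_mod_cast h
  have hsum : esymm n (p + 1) lam =
      lam p * P + ∑ s ∈ A.erase (Finset.Iic p), ∏ i ∈ s, lam i := by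
    rw [esymm, ← Finset.add_sum_erase A _ hmem, htop]
  nlinarith [mul_le_mul_of_nonneg_right hcard (mul_nonneg hK.le hP)]

/-- If `λ ∈ Γ̃_k` is ordered decreasingly, `S_k(λ) ≤ N₁` and `λ_i ≥ -K` for all `i`, then
`|λ_i| ≤ C₃` for all `i ≥ k` (one-indexed, i.e. `k ≤ i+1` for the Fin index). -/
theorem Sk_bounded_implies_small_eigenvalues_bounded
    (n k : ℕ) (hk : 1 ≤ k) (hkn : k ≤ n) (N₁ K : ℝ) (hN₁ : 0 < N₁) (hK : 0 < K) :
    ∃ C₃ : ℝ, 0 < C₃ ∧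
      ∀ lam ∈ GammaTilde n k, Antitone lam →
        esymm n k lam + esymm n (k - 1) lam ≤ N₁ →
        (∀ i : Fin n, -K ≤ lam i) →
        ∀ i : Fin n, k ≤ (i : ℕ) + 1 → |lam i| ≤ C₃ := by
  have hB : 0 < 2 ^ n * K := by positivity
  have hKB : K ≤ 2 ^ n * K := le_mul_of_one_le_left hK.le (one_le_pow₀ one_le_two)
  refine ⟨1 + 2 ^ n * K + N₁, by positivity, fun lam hmem hlam hS hlow i hi => ?_⟩
  obtain ⟨p, rfl⟩ : ∃ p, k = p + 1 := ⟨k - 1, by omega⟩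
  rw [Nat.add_sub_cancel] at hS
  have hpos : 0 < esymm n p lam := by
    rcases Nat.eq_zero_or_pos p with rfl | hp
    · simp [esymm]
    · exact hmem.1 p hp (by simp)
  have hip : lam i ≤ lam ⟨p, hkn⟩ := hlam (Fin.le_def.2 (Nat.le_of_succ_le_succ hi))
  refine abs_le.2 ⟨by linarith [hlow i], hip.trans ?_⟩
  by_contra! hlt
  have hE := sub_mul_prod_Iio_le_esymm hK hlam hlow ⟨p, hkn⟩ (by linarith)
  have hP : 1 ≤ ∏ j ∈ Finset.Iio (⟨p, hkn⟩ : Fin n), lam j := by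
    rw [← Finset.prod_const_one (s := Finset.Iio (⟨p, hkn⟩ : Fin n))]
    exact Finset.prod_le_prod (fun _ _ => zero_le_one) fun j hj => by
      linarith [hlam (Finset.mem_Iio.1 hj).le]
  have hmul := le_mul_of_one_le_right
    (show 0 ≤ lam ⟨p, hkn⟩ - 2 ^ n * K by linarith) hP
  simp only at hE
  linarith
end
end

section
/- Let n ≥ 3, K > 0 and 0 < m ≤ M. There exists a constant C > 0, depending only on n, K, m and M, such that for every λ ∈ Γ̃₃ with λ_i ≥ -K for all i and m ≤ σ₃(λ) + σ₂(λ) ≤ M, one has for every index 1 ≤ i ≤ n: C⁻¹ (σ₂(λ) + σ₁(λ)) ≤ F^{ii}(λ) · (K + 1 + λ_i)² ≤ C (σ₂(λ) + σ₁(λ)). -/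
open scoped BigOperators
noncomputable section

/-- `Γ̃₃ = Γ₂ ∩ {σ₃ + σ₂ > 0}`. -/
def GammaTilde3 (n : ℕ) : Set (Fin n → ℝ) :=
  GammaCone n 2 ∩ {lam | 0 < esymm n 3 lam + esymm n 2 lam}

/-- `F^{ii} = ∂(σ₃+σ₂)/∂λ_i = σ₂(λ|i) + σ₁(λ|i)`. -/
def Fii (n : ℕ) (lam : Fin n → ℝ) (i : Fin n) : ℝ :=
  esymmErase n 2 lam i + esymmErase n 1 lam i

/-- The `k`-th power sum of the entries of `lam` indexed by `S`, together with an entry `1`. -/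
def powSumOne {n : ℕ} (lam : Fin n → ℝ) (S : Finset (Fin n)) (k : ℕ) : ℝ :=
  1 + ∑ j ∈ S, lam j ^ k

/-- `σ₁` of the entries indexed by `S` together with an entry `1`. -/
def e1 {n : ℕ} (lam : Fin n → ℝ) (S : Finset (Fin n)) : ℝ := powSumOne lam S 1

/-- `σ₂` of the entries indexed by `S` together with an entry `1`. -/
def e2 {n : ℕ} (lam : Fin n → ℝ) (S : Finset (Fin n)) : ℝ :=
  (powSumOne lam S 1 ^ 2 - powSumOne lam S 2) / 2

/-- `σ₃` of the entries indexed by `S` together with an entry `1`. -/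
def e3 {n : ℕ} (lam : Fin n → ℝ) (S : Finset (Fin n)) : ℝ :=
  (powSumOne lam S 1 ^ 3 - 3 * powSumOne lam S 1 * powSumOne lam S 2
    + 2 * powSumOne lam S 3) / 6

section Identities

variable {ι : Type*}

lemma sum_powersetCard_succ_insert [DecidableEq ι] (f : ι → ℝ) {a : ι} {s : Finset ι} (ha : a ∉ s)
    (k : ℕ) :
    ∑ t ∈ (insert a s).powersetCard (k + 1), ∏ j ∈ t, f j
      = ∑ t ∈ s.powersetCard (k + 1), ∏ j ∈ t, f j
        + f a * ∑ t ∈ s.powersetCard k, ∏ j ∈ t, f j := by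
  rw [Finset.powersetCard_succ_insert ha, Finset.sum_union, Finset.sum_image, Finset.mul_sum]
  · congr 1
    refine Finset.sum_congr rfl fun t ht => ?_
    rw [Finset.prod_insert]
    exact fun h => ha ((Finset.mem_powersetCard.1 ht).1 h)
  · intro t ht u hu h
    have h1 : a ∉ t := fun h => ha ((Finset.mem_powersetCard.1 ht).1 h)
    have h2 : a ∉ u := fun h => ha ((Finset.mem_powersetCard.1 hu).1 h)
    rw [← Finset.erase_insert h1, ← Finset.erase_insert h2, h]
  · rw [Finset.disjoint_left]
    intro t ht h
    obtain ⟨u, -, rfl⟩ := Finset.mem_image.1 h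
    exact ha ((Finset.mem_powersetCard.1 ht).1 (Finset.mem_insert_self a u))

lemma sum_powersetCard_one_eq (f : ι → ℝ) (s : Finset ι) :
    ∑ t ∈ s.powersetCard 1, ∏ j ∈ t, f j = ∑ j ∈ s, f j := by
  simp [Finset.powersetCard_one]

lemma sum_powersetCard_two_eq (f : ι → ℝ) (s : Finset ι) :
    ∑ t ∈ s.powersetCard 2, ∏ j ∈ t, f j
      = ((∑ j ∈ s, f j) ^ 2 - ∑ j ∈ s, f j ^ 2) / 2 := by
  classical
  induction s using Finset.induction_on with
  | empty =>
    rw [Finset.powersetCard_eq_empty.2 (by simp)]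
    simp
  | insert a s ha ih =>
    rw [sum_powersetCard_succ_insert f ha 1, ih, sum_powersetCard_one_eq,
      Finset.sum_insert ha, Finset.sum_insert ha]
    ring

lemma sum_powersetCard_three_eq (f : ι → ℝ) (s : Finset ι) :
    ∑ t ∈ s.powersetCard 3, ∏ j ∈ t, f j
      = ((∑ j ∈ s, f j) ^ 3 - 3 * (∑ j ∈ s, f j) * (∑ j ∈ s, f j ^ 2)
        + 2 * ∑ j ∈ s, f j ^ 3) / 6 := by
  classical
  induction s using Finset.induction_on with
  | empty =>
    rw [Finset.powersetCard_eq_empty.2 (by simp)]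
    simp
  | insert a s ha ih =>
    rw [sum_powersetCard_succ_insert f ha 2, ih, sum_powersetCard_two_eq,
      Finset.sum_insert ha, Finset.sum_insert ha, Finset.sum_insert ha]
    ring

end Identities

section SumWithOne

variable {n : ℕ} (lam : Fin n → ℝ)

lemma e1_univ : e1 lam Finset.univ = 1 + esymm n 1 lam := by
  simp only [e1, powSumOne, esymm, sum_powersetCard_one_eq, pow_one]

lemma e2_univ : e2 lam Finset.univ = esymm n 2 lam + esymm n 1 lam := by
  simp only [e2, powSumOne, esymm, sum_powersetCard_one_eq, sum_powersetCard_two_eq, pow_one]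
  ring

lemma e3_univ : e3 lam Finset.univ = esymm n 3 lam + esymm n 2 lam := by
  simp only [e3, powSumOne, esymm, sum_powersetCard_two_eq, sum_powersetCard_three_eq, pow_one]
  ring

lemma Fii_eq_e2 (i : Fin n) : Fii n lam i = e2 lam (Finset.univ.erase i) := by
  simp only [e2, powSumOne, Fii, esymmErase, sum_powersetCard_one_eq, sum_powersetCard_two_eq,
    pow_one]
  ring

variable {lam} {S : Finset (Fin n)}

lemma powSumOne_eq_erase {i : Fin n} (hi : i ∈ S) (k : ℕ) :
    powSumOne lam S k = lam i ^ k + powSumOne lam (S.erase i) k := by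
  rw [powSumOne, powSumOne, ← Finset.add_sum_erase S _ hi]
  ring

lemma e1_eq_erase {i : Fin n} (hi : i ∈ S) : e1 lam S = lam i + e1 lam (S.erase i) := by
  simp only [e1, powSumOne_eq_erase hi, pow_one]

lemma e2_eq_erase {i : Fin n} (hi : i ∈ S) :
    e2 lam S = lam i * e1 lam (S.erase i) + e2 lam (S.erase i) := by
  simp only [e1, e2, powSumOne_eq_erase hi]
  ring

lemma e3_eq_erase {i : Fin n} (hi : i ∈ S) :
    e3 lam S = lam i * e2 lam (S.erase i) + e3 lam (S.erase i) := by
  simp only [e2, e3, powSumOne_eq_erase hi]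
  ring

lemma two_mul_e2_le : 2 * e2 lam S ≤ e1 lam S ^ 2 - 1 := by
  have : 0 ≤ ∑ j ∈ S, lam j ^ 2 := Finset.sum_nonneg fun j _ => sq_nonneg _
  simp only [e1, e2, powSumOne] at *
  linarith

lemma abs_powSumOne_three_le :
    |powSumOne lam S 3| ≤ powSumOne lam S 2 * √(powSumOne lam S 2) := by
  set r := √(powSumOne lam S 2) with hr
  have hnn : 0 ≤ ∑ j ∈ S, lam j ^ 2 := Finset.sum_nonneg fun j _ => sq_nonneg _
  have h1 : 1 ≤ r := by
    rw [hr, Real.one_le_sqrt, powSumOne]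
    linarith
  have hle : ∀ j ∈ S, |lam j| ≤ r := by
    intro j hj
    refine Real.abs_le_sqrt ?_
    have := Finset.single_le_sum (f := fun j => lam j ^ 2) (fun j _ => sq_nonneg _) hj
    simp only [powSumOne] at *
    linarith
  have habs : |∑ j ∈ S, lam j ^ 3| ≤ (∑ j ∈ S, lam j ^ 2) * r := by
    rw [Finset.sum_mul]
    refine (Finset.abs_sum_le_sum_abs _ _).trans (Finset.sum_le_sum fun j hj => ?_)
    rw [abs_pow, pow_succ, sq_abs]
    exact mul_le_mul_of_nonneg_left (hle j hj) (sq_nonneg _)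
  calc |powSumOne lam S 3| ≤ |1| + |∑ j ∈ S, lam j ^ 3| := abs_add_le _ _
    _ ≤ 1 * r + (∑ j ∈ S, lam j ^ 2) * r := by
        rw [abs_one, one_mul]
        exact add_le_add h1 habs
    _ = powSumOne lam S 2 * r := by
        rw [powSumOne]
        ring

/-- A weak form of Newton's inequality `σ₁σ₃ ≤ σ₂²`. -/
lemma e1_mul_e3_le : e1 lam S * e3 lam S ≤ e2 lam S ^ 2 := by
  have h3 := abs_powSumOne_three_le (lam := lam) (S := S)
  have hnn : 0 ≤ powSumOne lam S 2 :=
    add_nonneg zero_le_one (Finset.sum_nonneg fun j _ => sq_nonneg _)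
  simp only [e1, e2, e3]
  generalize powSumOne lam S 1 = a at *
  generalize powSumOne lam S 3 = c at *
  generalize powSumOne lam S 2 = b at *
  obtain ⟨r, hr, rfl⟩ : ∃ r, 0 ≤ r ∧ b = r ^ 2 :=
    ⟨√b, Real.sqrt_nonneg _, (Real.sq_sqrt hnn).symm⟩
  rw [Real.sqrt_sq hr] at h3
  have hac : a * c ≤ |a| * r ^ 3 := by
    calc a * c ≤ |a| * |c| := by rw [← abs_mul]; exact le_abs_self _
      _ ≤ |a| * (r ^ 2 * r) := mul_le_mul_of_nonneg_left h3 (abs_nonneg a)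
      _ = |a| * r ^ 3 := by ring
  have hxy : 4 * (|a| * r ^ 3) ≤ |a| ^ 4 + 3 * r ^ 4 := by
    nlinarith [sq_nonneg (|a| ^ 2 - r ^ 2), sq_nonneg (r * (|a| - r))]
  have ha4 : |a| ^ 4 = a ^ 4 := by
    rw [← abs_pow]
    exact abs_of_nonneg (by positivity)
  rw [ha4] at hxy
  nlinarith

lemma e1_erase_pos (h1 : 0 < e1 lam S) (h2 : 0 < e2 lam S) {i : Fin n} (hi : i ∈ S) :
    0 < e1 lam (S.erase i) := by
  have hs := two_mul_e2_le (lam := lam) (S := S.erase i)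
  rw [e1_eq_erase hi] at h1
  rw [e2_eq_erase hi] at h2
  by_contra! h
  nlinarith

lemma e2_erase_pos (h1 : 0 < e1 lam S) (h2 : 0 < e2 lam S) (h3 : 0 < e3 lam S) {i : Fin n}
    (hi : i ∈ S) : 0 < e2 lam (S.erase i) := by
  have hpos := e1_erase_pos h1 h2 hi
  have hN := e1_mul_e3_le (lam := lam) (S := S.erase i)
  rw [e2_eq_erase hi] at h2
  rw [e3_eq_erase hi] at h3
  by_contra! h
  nlinarith [mul_pos hpos h3]

lemma one_le_e1 (h1 : 0 < e1 lam S) (h2 : 0 < e2 lam S) : 1 ≤ e1 lam S := by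
  have hs := two_mul_e2_le (lam := lam) (S := S)
  nlinarith

lemma e3_le_mul_e2_erase (h1 : 0 < e1 lam S) (h2 : 0 < e2 lam S) (h3 : 0 < e3 lam S) {i : Fin n}
    (hi : i ∈ S) : e3 lam S ≤ e1 lam S * e2 lam (S.erase i) := by
  have hp1 := e1_erase_pos h1 h2 hi
  have hp2 := e2_erase_pos h1 h2 h3 hi
  have hN := e1_mul_e3_le (lam := lam) (S := S.erase i)
  have hs := two_mul_e2_le (lam := lam) (S := S.erase i)
  rw [e3_eq_erase hi, e1_eq_erase hi]
  have : e3 lam (S.erase i) ≤ e1 lam (S.erase i) * e2 lam (S.erase i) := by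
    refine le_of_mul_le_mul_left ?_ hp1
    nlinarith
  linarith

lemma e3_le_mul_e2 (h1 : 0 < e1 lam S) (h2 : 0 < e2 lam S) :
    e3 lam S ≤ e1 lam S * e2 lam S := by
  have hN := e1_mul_e3_le (lam := lam) (S := S)
  have hs := two_mul_e2_le (lam := lam) (S := S)
  refine le_of_mul_le_mul_left ?_ h1
  nlinarith

lemma abs_powSumOne_le {B : ℝ} (hB : 1 ≤ B) (h : ∀ j ∈ S, |lam j| ≤ B) {k : ℕ} (hk : k ≠ 0) :
    |powSumOne lam S k| ≤ ((n + 1) * B) ^ k := by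
  have hcard : (S.card : ℝ) ≤ n := by
    exact_mod_cast (Finset.card_le_univ S).trans_eq (Fintype.card_fin n)
  have hBk : 1 ≤ B ^ k := one_le_pow₀ hB
  have hsum : |∑ j ∈ S, lam j ^ k| ≤ n * B ^ k := by
    calc |∑ j ∈ S, lam j ^ k| ≤ ∑ j ∈ S, |lam j ^ k| := Finset.abs_sum_le_sum_abs _ _
      _ ≤ ∑ _j ∈ S, B ^ k := Finset.sum_le_sum fun j hj => by
          rw [abs_pow]
          exact pow_le_pow_left₀ (abs_nonneg _) (h j hj) k
      _ = S.card * B ^ k := by rw [Finset.sum_const, nsmul_eq_mul]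
      _ ≤ n * B ^ k := by gcongr
  have hpow : (n + 1 : ℝ) ≤ (n + 1) ^ k := by
    refine le_self_pow₀ ?_ hk
    linarith [(Nat.cast_nonneg n : (0 : ℝ) ≤ n)]
  calc |powSumOne lam S k| ≤ |1| + |∑ j ∈ S, lam j ^ k| := abs_add_le _ _
    _ ≤ (n + 1) * B ^ k := by
        rw [abs_one]
        linarith
    _ ≤ (n + 1) ^ k * B ^ k := by gcongr
    _ = ((n + 1) * B) ^ k := (mul_pow _ _ _).symm

lemma abs_e_le {B : ℝ} (hB : 1 ≤ B) (h : ∀ j ∈ S, |lam j| ≤ B) :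
    |e1 lam S| ≤ ((n + 1) * B) ^ 3 ∧ |e2 lam S| ≤ ((n + 1) * B) ^ 3 ∧
      |e3 lam S| ≤ ((n + 1) * B) ^ 3 := by
  have q1 := abs_powSumOne_le hB h one_ne_zero
  have q2 := abs_powSumOne_le hB h two_ne_zero
  have q3 := abs_powSumOne_le hB h three_ne_zero
  have hD : 1 ≤ (n + 1) * B := by nlinarith [(Nat.cast_nonneg n : (0 : ℝ) ≤ n)]
  simp only [e1, e2, e3]
  generalize powSumOne lam S 1 = a at *
  generalize powSumOne lam S 2 = b at *
  generalize powSumOne lam S 3 = c at *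
  generalize (n + 1) * B = D at *
  rw [pow_one] at q1
  have h23 : D ^ 2 ≤ D ^ 3 := pow_le_pow_right₀ hD (by norm_num)
  have h13 : D ≤ D ^ 3 := le_self_pow₀ hD (by norm_num)
  have ha2 : |a ^ 2| ≤ D ^ 2 := by
    rw [abs_pow]
    exact pow_le_pow_left₀ (abs_nonneg _) q1 2
  have ha3 : |a ^ 3| ≤ D ^ 3 := by
    rw [abs_pow]
    exact pow_le_pow_left₀ (abs_nonneg _) q1 3
  have hab : |a * b| ≤ D * D ^ 2 := by
    rw [abs_mul]
    exact mul_le_mul q1 q2 (abs_nonneg _) (by linarith)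
  have hDD : D * D ^ 2 = D ^ 3 := by ring
  rw [hDD] at hab
  rw [abs_le] at *
  refine ⟨⟨by linarith, by linarith⟩, ?_, ?_⟩
  · rw [abs_le]
    constructor <;> linarith
  · rw [abs_le]
    constructor <;> linarith

lemma powSum_nonneg_of_nonneg {c : ℝ} (hc : 0 ≤ c) {y : Fin n → ℝ} (hy : ∀ j, 0 ≤ y j)
    (S : Finset (Fin n)) :
    0 ≤ c + ∑ j ∈ S, y j ∧
    c ^ 2 + ∑ j ∈ S, y j ^ 2 ≤ (c + ∑ j ∈ S, y j) ^ 2 ∧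
      0 ≤ (c + ∑ j ∈ S, y j) ^ 3 - 3 * (c + ∑ j ∈ S, y j) * (c ^ 2 + ∑ j ∈ S, y j ^ 2)
        + 2 * (c ^ 3 + ∑ j ∈ S, y j ^ 3) := by
  induction S using Finset.induction_on with
  | empty =>
    simp only [Finset.sum_empty, add_zero]
    exact ⟨hc, le_rfl, le_of_eq (by ring)⟩
  | insert a s ha ih =>
    rw [Finset.sum_insert ha, Finset.sum_insert ha, Finset.sum_insert ha]
    generalize ∑ j ∈ s, y j = u at *
    generalize ∑ j ∈ s, y j ^ 2 = v at *
    generalize ∑ j ∈ s, y j ^ 3 = w at *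
    obtain ⟨h1, h2, h3⟩ := ih
    have := hy a
    refine ⟨by linarith, by nlinarith, ?_⟩
    nlinarith [mul_nonneg this (sub_nonneg.2 h2)]

end SumWithOne

section Semiconvex

variable {n : ℕ} {lam : Fin n → ℝ} {K : ℝ}

/-- Lower bound for `σ₂` of `N` numbers `≥ -K` with power sums `a`, `b`. -/
lemma semiconvex_two {N A a b : ℝ} (hK : 0 < K) (hN : 1 ≤ N) (ha : 0 < a)
    (q2 : b + 2 * K * a + N * K ^ 2 ≤ (a + N * K) ^ 2) (hA : 4 * (1 + N * K) ^ 3 ≤ A) :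
    -(A * (a + 1)) ≤ (a ^ 2 - b) / 2 := by
  have hNK2 : N * K ^ 2 ≤ (N * K) ^ 2 := by
    rw [mul_pow]
    exact mul_le_mul_of_nonneg_right (le_self_pow₀ hN two_ne_zero) (sq_nonneg K)
  obtain ⟨G, hG⟩ : ∃ G : ℝ, G = N * K := ⟨_, rfl⟩
  have hG0 : 0 ≤ G := by rw [hG]; positivity
  rw [← hG] at q2 hA hNK2
  have hA1 : G ≤ A := by nlinarith [pow_nonneg hG0 3, pow_nonneg hG0 2]
  have hA2 : G ^ 2 ≤ A := by nlinarith [pow_nonneg hG0 3, pow_nonneg hG0 2]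
  have hKa : 0 < K * a := mul_pos hK ha
  have hNK0 : 0 ≤ N * K ^ 2 := by positivity
  have := mul_le_mul_of_nonneg_right hA1 ha.le
  linarith

/-- Lower bound for `σ₃` of `N` numbers `≥ -K` with power sums `a`, `b`, `c`. -/
lemma semiconvex_three {N A a b c : ℝ} (hK : 0 < K) (hN : 1 ≤ N) (ha : 0 < a)
    (q2 : b + 2 * K * a + N * K ^ 2 ≤ (a + N * K) ^ 2)
    (q3 : 0 ≤ (a + N * K) ^ 3 - 3 * (a + N * K) * (b + 2 * K * a + N * K ^ 2)
      + 2 * (c + 3 * K * b + 3 * K ^ 2 * a + N * K ^ 3))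
    (hQ2 : 0 ≤ b + 2 * K * a + N * K ^ 2) (hA : 4 * (1 + N * K) ^ 3 ≤ A) :
    -(A * (a ^ 2 + 1)) ≤ (a ^ 3 - 3 * a * b + 2 * c) / 6 := by
  have hid : a ^ 3 - 3 * a * b + 2 * c
      = ((a + N * K) ^ 3 - 3 * (a + N * K) * (b + 2 * K * a + N * K ^ 2)
          + 2 * (c + 3 * K * b + 3 * K ^ 2 * a + N * K ^ 3))
        - 3 * K * (N - 2) * ((a + N * K) ^ 2 - (b + 2 * K * a + N * K ^ 2))
        + 3 * K ^ 2 * (N - 1) * (N - 2) * (a + N * K) - K ^ 3 * N * (N - 1) * (N - 2) := by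
    ring
  have c2 : -(3 * (N * K) ^ 2) ≤ 3 * K ^ 2 * (N - 1) * (N - 2) := by
    have : 0 ≤ N ^ 2 + (N - 1) * (N - 2) := by nlinarith
    linarith [mul_nonneg (sq_nonneg K) this]
  have c3 : K ^ 3 * N * (N - 1) * (N - 2) ≤ (N * K) ^ 3 := by
    have : 0 ≤ N ^ 3 - N * (N - 1) * (N - 2) := by nlinarith
    linarith [mul_nonneg (pow_nonneg hK.le 3) this]
  have c1 : 3 * K * (N - 2) ≤ 3 * (N * K) := by linarith
  obtain ⟨G, hG⟩ : ∃ G : ℝ, G = N * K := ⟨_, rfl⟩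
  have hG0 : 0 ≤ G := by rw [hG]; positivity
  rw [← hG] at q2 q3 hA hid c1 c2 c3
  generalize b + 2 * K * a + N * K ^ 2 = Q at *
  have b1 : 3 * K * (N - 2) * ((a + G) ^ 2 - Q) ≤ 3 * G * (a + G) ^ 2 :=
    (mul_le_mul_of_nonneg_right c1 (sub_nonneg.2 q2)).trans
      (mul_le_mul_of_nonneg_left (sub_le_self _ hQ2) (by positivity))
  have b2 := mul_le_mul_of_nonneg_right c2 (show 0 ≤ a + G by linarith)
  have b4 : (a + G) ^ 2 ≤ 2 * a ^ 2 + 2 * G ^ 2 := by linarith [sq_nonneg (a - G)]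
  have b5 : a + G ≤ a ^ 2 + 1 + G := by linarith [sq_nonneg (a - 1 / 2)]
  have b6 : 3 * G * (a + G) ^ 2 ≤ 3 * G * (2 * a ^ 2 + 2 * G ^ 2) := by gcongr
  have b7 : 3 * G ^ 2 * (a + G) ≤ 3 * G ^ 2 * (a ^ 2 + 1 + G) := by gcongr
  have d1 : 6 * G + 3 * G ^ 2 ≤ 6 * A := by linarith [pow_nonneg hG0 3, pow_nonneg hG0 2]
  have d2 : 10 * G ^ 3 + 3 * G ^ 2 ≤ 6 * A := by linarith [pow_nonneg hG0 3, pow_nonneg hG0 2]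
  have d3 := mul_le_mul_of_nonneg_right d1 (sq_nonneg a)
  linarith

lemma semiconvex_bounds (hK : 0 < K) (hlam : ∀ j, -K ≤ lam j) {S : Finset (Fin n)}
    (h1 : 0 < e1 lam S) {A : ℝ} (hA : A = 4 * (1 + (n + 1) * (K + 1)) ^ 3) :
    (∀ j ∈ S, lam j ≤ e1 lam S + A) ∧ -(A * (e1 lam S + 1)) ≤ e2 lam S ∧
      -(A * (e1 lam S ^ 2 + 1)) ≤ e3 lam S := by
  have hcard : (S.card : ℝ) ≤ n := by
    exact_mod_cast (Finset.card_le_univ S).trans_eq (Fintype.card_fin n)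
  have hcard0 : (0 : ℝ) ≤ S.card := Nat.cast_nonneg _
  have hy : ∀ j, 0 ≤ lam j + K := fun j => by linarith [hlam j]
  obtain ⟨q1, q2, q3⟩ := powSum_nonneg_of_nonneg (c := 1 + K) (by linarith) hy S
  have hQ2 : 0 ≤ (1 + K) ^ 2 + ∑ j ∈ S, (lam j + K) ^ 2 :=
    add_nonneg (sq_nonneg _) (Finset.sum_nonneg fun j _ => sq_nonneg _)
  have r1 : 1 + K + ∑ j ∈ S, (lam j + K) = powSumOne lam S 1 + (S.card + 1) * K := by
    simp only [powSumOne, pow_one, Finset.sum_add_distrib, Finset.sum_const, nsmul_eq_mul]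
    ring
  have r2 : (1 + K) ^ 2 + ∑ j ∈ S, (lam j + K) ^ 2
      = powSumOne lam S 2 + 2 * K * powSumOne lam S 1 + (S.card + 1) * K ^ 2 := by
    simp only [powSumOne, pow_one, add_sq, Finset.sum_add_distrib, Finset.sum_const, nsmul_eq_mul,
      ← Finset.sum_mul, ← Finset.mul_sum]
    ring
  have r3 : (1 + K) ^ 3 + ∑ j ∈ S, (lam j + K) ^ 3
      = powSumOne lam S 3 + 3 * K * powSumOne lam S 2 + 3 * K ^ 2 * powSumOne lam S 1
        + (S.card + 1) * K ^ 3 := by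
    have hcube : ∀ j, (lam j + K) ^ 3
        = lam j ^ 3 + 3 * K * lam j ^ 2 + 3 * K ^ 2 * lam j + K ^ 3 := fun j => by ring
    simp only [powSumOne, pow_one, hcube, Finset.sum_add_distrib, Finset.sum_const, nsmul_eq_mul,
      ← Finset.mul_sum]
    ring
  have hj : ∀ j ∈ S, lam j ≤ powSumOne lam S 1 + (S.card + 1) * K := by
    intro j hj
    have := Finset.single_le_sum (f := fun j => lam j + K) (fun j _ => hy j) hj
    linarith
  rw [r1] at q1
  rw [r1, r2] at q2
  rw [r1, r2, r3] at q3
  rw [r2] at hQ2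
  simp only [e1, e2, e3] at *
  generalize powSumOne lam S 1 = a at *
  generalize powSumOne lam S 2 = b at *
  generalize powSumOne lam S 3 = c at *
  obtain ⟨N, hN⟩ : ∃ N : ℝ, N = S.card + 1 := ⟨_, rfl⟩
  rw [← hN] at hj q1 q2 q3 hQ2
  have hN1 : 1 ≤ N := by linarith
  have hNA : 4 * (1 + N * K) ^ 3 ≤ A := by
    rw [hA]
    have : N * K ≤ (n + 1) * (K + 1) := by
      apply mul_le_mul <;> linarith
    gcongr
  have hNK : 0 ≤ N * K := by positivity
  refine ⟨fun j h => ?_, semiconvex_two hK hN1 h1 q2 hNA, semiconvex_three hK hN1 h1 q2 q3 hQ2 hNA⟩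
  nlinarith [hj j h, pow_nonneg hNK 3, pow_nonneg hNK 2]

lemma e1_le_mul {S : Finset (Fin n)} {q : ℝ} (hq : 1 ≤ q) (h : ∀ j ∈ S, lam j ≤ q) :
    e1 lam S ≤ (n + 1) * q := by
  have hcard : (S.card : ℝ) ≤ n := by
    exact_mod_cast (Finset.card_le_univ S).trans_eq (Fintype.card_fin n)
  have := Finset.sum_le_card_nsmul S lam q h
  rw [nsmul_eq_mul] at this
  simp only [e1, powSumOne, pow_one]
  nlinarith

end Semiconvex

section RealInequalities

variable {L q a b D K M m t₁ t₂ t₃ x s : ℝ}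

lemma mul_le_of_two_large {A : ℝ} (hA : 1 ≤ A) (hM : 0 ≤ M) (hqL : q ≤ L) (hqA : 8 * A ≤ q)
    (hqA2 : 4 * A ^ 2 ≤ q) (ht : 0 < t₁) (htq : t₁ ≤ A * q) (h2 : -(A * (t₁ + 1)) ≤ t₂)
    (h3 : -(A * (t₁ ^ 2 + 1)) ≤ t₃) (hσ : L * (q * t₁ + t₂) + (q * t₂ + t₃) ≤ M) :
    q * t₁ ≤ 2 * M + 6 * A := by
  have hL : 1 ≤ L := by linarith
  have k1 : -(2 * L * (A * (t₁ + 1))) ≤ (L + q) * t₂ := by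
    have : 0 ≤ A * (t₁ + 1) := by positivity
    nlinarith
  have k2 : 2 * L * (A * t₁) ≤ L * (q * t₁) / 4 := by
    have := mul_le_mul_of_nonneg_right hqA (mul_pos (zero_lt_one.trans_le hL) ht).le
    linarith
  have k3 : A * t₁ ^ 2 ≤ L * (q * t₁) / 4 := by
    have e1 : A * t₁ ^ 2 ≤ A * t₁ * (A * q) := by
      rw [pow_two, ← mul_assoc]
      gcongr
    have e2 := mul_le_mul_of_nonneg_right (hqA2.trans hqL)
      (mul_pos (show 0 < q by linarith) ht).le
    linarith
  have k4 : L * (q * t₁) ≤ L * (2 * M + 6 * A) := by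
    have : M + A ≤ L * (M + A) := le_mul_of_one_le_left (by linarith) hL
    linarith
  exact le_of_mul_le_mul_left k4 (by linarith)

lemma comparable_two_large_of_large (hD : 1 ≤ D) (hM : 0 ≤ M) (hK : 0 < K)
    (ha : 20 * D + M + K + 1 ≤ a) (hb : 20 * D + M + K + 1 ≤ b)
    (ht : 0 < t₁) (ht' : t₁ ≤ 1 / 2) (h2 : t₂ ≤ -(1 / 4)) (h2' : -D ≤ t₂) (h3 : |t₃| ≤ D)
    (hσ0 : 0 ≤ a * (b * t₁ + t₂) + (b * t₂ + t₃)) (hσ : a * (b * t₁ + t₂) + (b * t₂ + t₃) ≤ M) :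
    a * b + (a + b) * t₁ + t₂ ≤ 24 * D ^ 2 * ((b * t₁ + t₂) * (K + 1 + a) ^ 2) ∧
      (b * t₁ + t₂) * (K + 1 + a) ^ 2 ≤ 24 * D ^ 2 * (a * b + (a + b) * t₁ + t₂) := by
  rw [abs_le] at h3
  have ha0 : 0 < a := by linarith
  have hb0 : 0 < b := by linarith
  set F := b * t₁ + t₂ with hF
  set σ := a * b + (a + b) * t₁ + t₂ with hσdef
  have hl : b / 8 ≤ a * F := by nlinarith
  have hu : a * F ≤ 2 * b * D := by nlinarith
  have hF0 : 0 ≤ F := by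
    have : 0 ≤ a * F := by linarith
    exact nonneg_of_mul_nonneg_right this ha0
  have hab : 20 * D * 1 ≤ a * b := by apply mul_le_mul <;> linarith
  have hσl : a * b / 2 ≤ σ := by nlinarith
  have hσu : σ ≤ 2 * (a * b) := by nlinarith
  have hX : a ^ 2 ≤ (K + 1 + a) ^ 2 := by gcongr; linarith
  have hX' : (K + 1 + a) ^ 2 ≤ (2 * a) ^ 2 := by gcongr; linarith
  have hYl : a * b / 8 ≤ F * (K + 1 + a) ^ 2 := by
    have := mul_le_mul_of_nonneg_left hX hF0
    nlinarith
  have hYu : F * (K + 1 + a) ^ 2 ≤ 8 * D * (a * b) := by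
    have := mul_le_mul_of_nonneg_left hX' hF0
    nlinarith
  have hDD : 1 ≤ D ^ 2 := one_le_pow₀ hD
  have hab0 : 0 < a * b := mul_pos ha0 hb0
  constructor <;> nlinarith

lemma comparable_two_large_of_bounded (hD : 1 ≤ D) (hK : 0 < K) (hM : 0 ≤ M) (hKD : K + 1 ≤ D)
    (ha : 20 * D + M + K + 1 ≤ b) (hb : b ≤ a)
    (ht : 0 < t₁) (ht' : t₁ ≤ 1 / 2) (h2 : t₂ ≤ 0) (h2' : -D ≤ t₂) (hx : |x| ≤ D) (hxK : -K ≤ x)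
    (hσ : s = a * b + (a + b) * t₁ + t₂) :
    s ≤ 24 * D ^ 2 * ((s - x * (a + b + t₁ - x)) * (K + 1 + x) ^ 2) ∧
      (s - x * (a + b + t₁ - x)) * (K + 1 + x) ^ 2 ≤ 24 * D ^ 2 * s := by
  rw [abs_le] at hx
  have hb0 : 0 < b := by linarith
  have ha0 : 0 < a := by linarith
  have hab : 20 * D * a ≤ a * b := by nlinarith
  have hσl : a * b / 2 ≤ s := by nlinarith
  have hσu : s ≤ 2 * (a * b) := by nlinarith
  have hxe : |x * (a + b + t₁ - x)| ≤ D * (3 * a) := by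
    rw [abs_mul]
    refine mul_le_mul (abs_le.2 hx) ?_ (abs_nonneg _) (by linarith)
    rw [abs_le]
    constructor <;> linarith
  rw [abs_le] at hxe
  set F := s - x * (a + b + t₁ - x) with hF
  have hFl : a * b / 4 ≤ F := by linarith
  have hFu : F ≤ 3 * (a * b) := by linarith
  have hF0 : 0 ≤ F := by nlinarith [mul_pos ha0 hb0]
  have hX : 1 ≤ (K + 1 + x) ^ 2 := one_le_pow₀ (by linarith)
  have hX' : (K + 1 + x) ^ 2 ≤ (2 * D) ^ 2 := by gcongr <;> linarith
  have hYl := mul_le_mul_of_nonneg_left hX hF0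
  have hYu := mul_le_mul_of_nonneg_left hX' hF0
  have hDD : 1 ≤ D ^ 2 := one_le_pow₀ hD
  have hab0 : 0 < a * b := mul_pos ha0 hb0
  constructor <;> nlinarith

/-- All entries but the one equal to `L` are bounded, and the index under consideration belongs to
a bounded entry `x`. -/
lemma comparable_one_large_of_bounded (hD : 1 ≤ D) (hK : 0 < K) (hKD : K + 1 ≤ D)
    (hL : 16 * D ^ 2 ≤ L) (hx : |x| ≤ D) (hxK : -K ≤ x) (h1 : |t₁| ≤ D) (h2 : |t₂| ≤ D)
    (ht : 0 < t₁) (ht2 : 2 * t₂ ≤ t₁ ^ 2 - 1) (hs1 : 1 ≤ x + t₁)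
    (hs2 : 0 < x * t₁ + t₂) :
    L * (x + t₁) + (x * t₁ + t₂) ≤ 32 * D ^ 3 * ((L * t₁ + t₂) * (K + 1 + x) ^ 2) ∧
      (L * t₁ + t₂) * (K + 1 + x) ^ 2 ≤ 32 * D ^ 3 * (L * (x + t₁) + (x * t₁ + t₂)) := by
  have hD2 : D ≤ D ^ 2 := le_self_pow₀ hD two_ne_zero
  have hD3 : D ^ 2 ≤ D ^ 3 := pow_le_pow_right₀ hD (by norm_num)
  have hL0 : 0 < L := by nlinarith
  have hxt1 : |x * t₁| ≤ D * D := by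
    rw [abs_mul]
    exact mul_le_mul hx h1 (abs_nonneg _) (by linarith)
  rw [abs_le] at *
  have htl : 1 ≤ 4 * D * t₁ := by
    by_contra! h
    have ht4 : t₁ ≤ 1 / 4 := by nlinarith
    have : x * t₁ ≤ D * t₁ := mul_le_mul_of_nonneg_right hx.2 ht.le
    have : t₁ ^ 2 ≤ (1 / 4) ^ 2 := pow_le_pow_left₀ ht.le ht4 2
    linarith
  have hLD : L ≤ L * D := le_mul_of_one_le_right hL0.le hD
  have hFl : L ≤ 8 * D * (L * t₁ + t₂) := by
    have e1 := mul_le_mul_of_nonneg_left htl hL0.le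
    have e2 := mul_le_mul_of_nonneg_left h2.1 (show 0 ≤ D by linarith)
    linarith
  have hFu : L * t₁ + t₂ ≤ 2 * D * L := by
    have e1 := mul_le_mul_of_nonneg_left h1.2 hL0.le
    linarith
  have hF0 : 0 ≤ L * t₁ + t₂ := by
    have : 0 ≤ 8 * D * (L * t₁ + t₂) := by linarith
    exact nonneg_of_mul_nonneg_right this (by linarith)
  have hσl : L ≤ L * (x + t₁) + (x * t₁ + t₂) := by
    have e1 := mul_le_mul_of_nonneg_left hs1 hL0.le
    linarith
  have hσu : L * (x + t₁) + (x * t₁ + t₂) ≤ 4 * D * L := by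
    have e1 : L * (x + t₁) ≤ L * (2 * D) := mul_le_mul_of_nonneg_left (by linarith) hL0.le
    linarith
  set F := L * t₁ + t₂
  set σ := L * (x + t₁) + (x * t₁ + t₂)
  have hX : 1 ≤ (K + 1 + x) ^ 2 := one_le_pow₀ (by linarith)
  have hX' : (K + 1 + x) ^ 2 ≤ (2 * D) ^ 2 := by gcongr <;> linarith
  have hYl := mul_le_mul_of_nonneg_left hX hF0
  have hYu := mul_le_mul_of_nonneg_left hX' hF0
  set Y := F * (K + 1 + x) ^ 2
  rw [mul_one] at hYl
  have hY0 : 0 ≤ Y := hF0.trans hYl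
  constructor
  · calc σ ≤ 4 * D * L := hσu
      _ ≤ 4 * D * (8 * D * Y) := by
        refine mul_le_mul_of_nonneg_left (hFl.trans ?_) (by linarith)
        exact mul_le_mul_of_nonneg_left hYl (by linarith)
      _ = 32 * D ^ 2 * Y := by ring
      _ ≤ 32 * D ^ 3 * Y := by gcongr
  · calc Y ≤ F * (2 * D) ^ 2 := hYu
      _ ≤ (2 * D * L) * (2 * D) ^ 2 := by gcongr
      _ = 8 * D ^ 3 * L := by ring
      _ ≤ 32 * D ^ 3 * L := by
        refine mul_le_mul_of_nonneg_right ?_ hL0.le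
        nlinarith
      _ ≤ 32 * D ^ 3 * σ := by gcongr

/-- All entries but the one equal to `L` are bounded, and the index under consideration is that of
`L`; `t₁, t₂, t₃` are the elementary symmetric functions of the other entries. -/
lemma comparable_one_large_self (hD : 1 ≤ D) (hK : 0 < K) (hKD : K + 1 ≤ D) (hm : 0 < m)
    (hL : 16 * D ^ 2 ≤ L) (h1 : |t₁| ≤ D) (h2 : |t₂| ≤ D) (h3 : |t₃| ≤ D) (ht1 : 1 ≤ t₁)
    (ht2 : 0 < t₂) (hσm : m ≤ (L + t₁) * t₂) (hM : 0 ≤ M) (hσM : L * t₂ + t₃ ≤ M) :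
    L * t₁ + t₂ ≤ (8 * D / m + 4 * (M + D)) * (t₂ * (K + 1 + L) ^ 2) ∧
      t₂ * (K + 1 + L) ^ 2 ≤ (8 * D / m + 4 * (M + D)) * (L * t₁ + t₂) := by
  have hD2 : D ≤ D ^ 2 := le_self_pow₀ hD two_ne_zero
  rw [abs_le] at *
  have hL0 : 0 < L := by nlinarith
  have hDL : D ≤ L := by linarith
  have hG : m ≤ 2 * L * t₂ := by nlinarith
  have hG' : L * t₂ ≤ M + D := by linarith
  have hX : L ^ 2 ≤ (K + 1 + L) ^ 2 := by gcongr; linarith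
  have hX' : (K + 1 + L) ^ 2 ≤ (2 * L) ^ 2 := by gcongr; linarith
  have hσl : L ≤ L * t₁ + t₂ := by nlinarith
  have hσu : L * t₁ + t₂ ≤ 4 * D * L := by nlinarith
  have hYl : m * L ≤ 2 * (t₂ * (K + 1 + L) ^ 2) := by
    have := mul_le_mul_of_nonneg_left hX ht2.le
    nlinarith
  have hYu : t₂ * (K + 1 + L) ^ 2 ≤ 4 * (M + D) * L := by
    have := mul_le_mul_of_nonneg_left hX' ht2.le
    nlinarith
  set Y := t₂ * (K + 1 + L) ^ 2
  have hY0 : 0 ≤ Y := by positivity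
  have hdm : 0 ≤ 8 * D / m := by positivity
  constructor
  · have : 4 * D * L ≤ 8 * D / m * Y := by
      rw [div_mul_eq_mul_div, le_div_iff₀ hm]
      have := mul_le_mul_of_nonneg_left hYl (show 0 ≤ 4 * D by linarith)
      linarith
    have := mul_nonneg (show 0 ≤ 4 * (M + D) by linarith) hY0
    linarith
  · have e1 := mul_nonneg hdm (hL0.le.trans hσl)
    have e2 := mul_le_mul_of_nonneg_left hσl (show 0 ≤ 4 * (M + D) by linarith)
    linarith

lemma comparable_of_bounded {F : ℝ} (hD : 1 ≤ D) (hK : 0 < K) (hKD : K + 1 ≤ D) (hm : 0 < m)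
    (hx : |x| ≤ D) (hxK : -K ≤ x) (hF : F ≤ D) (hs : s ≤ D) (hF0 : 0 < F)
    (hmF : m ≤ D * F) (hms : m ≤ D * s) :
    s ≤ 4 * D ^ 4 / m * (F * (K + 1 + x) ^ 2) ∧
      F * (K + 1 + x) ^ 2 ≤ 4 * D ^ 4 / m * s := by
  rw [abs_le] at hx
  have hX : 1 ≤ (K + 1 + x) ^ 2 := one_le_pow₀ (by linarith)
  have hX' : (K + 1 + x) ^ 2 ≤ (2 * D) ^ 2 := by gcongr <;> linarith
  have hYl := mul_le_mul_of_nonneg_left hX hF0.le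
  have hYu := mul_le_mul_of_nonneg_left hX' hF0.le
  set Y := F * (K + 1 + x) ^ 2
  have hD24 : D ^ 2 ≤ D ^ 4 := pow_le_pow_right₀ hD (by norm_num)
  have hY0 : 0 ≤ Y := by positivity
  rw [div_mul_eq_mul_div, div_mul_eq_mul_div, le_div_iff₀ hm, le_div_iff₀ hm]
  constructor
  · calc s * m ≤ D * (D * F) := by
          apply mul_le_mul hs hmF hm.le (by linarith)
      _ = D ^ 2 * F := by ring
      _ ≤ D ^ 4 * Y := by
        apply mul_le_mul hD24 (by linarith) hF0.le (by positivity)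
      _ ≤ 4 * D ^ 4 * Y := by nlinarith [mul_nonneg (pow_nonneg (zero_le_one.trans hD) 4) hY0]
  · calc Y * m ≤ (D * (2 * D) ^ 2) * (D * s) := by
          refine mul_le_mul (hYu.trans ?_) hms hm.le (by positivity)
          gcongr
      _ = 4 * D ^ 4 * s := by ring

end RealInequalities

section Comparability

variable {n : ℕ} {lam : Fin n → ℝ} {K M m B : ℝ}

lemma one_le_and_le_cube (hB : 1 ≤ B) : 1 ≤ ((n + 1) * B) ^ 3 ∧ B ≤ ((n + 1) * B) ^ 3 := by
  have h : B ≤ (n + 1) * B := by nlinarith [(Nat.cast_nonneg n : (0 : ℝ) ≤ n)]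
  have h' : (n + 1) * B ≤ ((n + 1) * B) ^ 3 := le_self_pow₀ (hB.trans h) three_ne_zero
  constructor <;> linarith

lemma comparable_of_forall_abs_le (hK : 0 < K) (hm : 0 < m) (h1 : 0 < e1 lam Finset.univ)
    (h2 : 0 < e2 lam Finset.univ) (hσm : m ≤ e3 lam Finset.univ) (hlam : ∀ j, -K ≤ lam j)
    (hB : K + 1 ≤ B) (h : ∀ j, |lam j| ≤ B) {D : ℝ} (hD : D = ((n + 1) * B) ^ 3) (i : Fin n) :
    e2 lam Finset.univ ≤ 4 * D ^ 4 / m * (e2 lam (Finset.univ.erase i) * (K + 1 + lam i) ^ 2) ∧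
      e2 lam (Finset.univ.erase i) * (K + 1 + lam i) ^ 2
        ≤ 4 * D ^ 4 / m * e2 lam Finset.univ := by
  have hB1 : 1 ≤ B := by linarith
  obtain ⟨hD1, hBD⟩ := one_le_and_le_cube (n := n) hB1
  obtain ⟨u1, u2, -⟩ := abs_e_le (S := Finset.univ) hB1 fun j _ => h j
  obtain ⟨-, v2, -⟩ := abs_e_le (S := Finset.univ.erase i) hB1 fun j _ => h j
  rw [← hD] at *
  have h3 : 0 < e3 lam Finset.univ := hm.trans_le hσm
  have hF := e2_erase_pos h1 h2 h3 (Finset.mem_univ i)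
  have hF3 := e3_le_mul_e2_erase h1 h2 h3 (Finset.mem_univ i)
  have hs3 := e3_le_mul_e2 h1 h2
  refine comparable_of_bounded hD1 hK (hB.trans hBD) hm ((h i).trans hBD) (hlam i)
    ((le_abs_self _).trans v2) ((le_abs_self _).trans u2) hF ?_ ?_
  · exact (hσm.trans hF3).trans (mul_le_mul_of_nonneg_right ((le_abs_self _).trans u1) hF.le)
  · exact (hσm.trans hs3).trans (mul_le_mul_of_nonneg_right ((le_abs_self _).trans u1) h2.le)

lemma comparable_of_forall_ne_abs_le (hK : 0 < K) (hm : 0 < m) (hM : 0 ≤ M)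
    (h1 : 0 < e1 lam Finset.univ) (h2 : 0 < e2 lam Finset.univ) (hσm : m ≤ e3 lam Finset.univ)
    (hσM : e3 lam Finset.univ ≤ M) (hlam : ∀ j, -K ≤ lam j) (hB : K + 1 ≤ B) {p : Fin n}
    (h : ∀ j, j ≠ p → |lam j| ≤ B) {D : ℝ} (hD : D = ((n + 1) * B) ^ 3)
    (hL : 16 * D ^ 2 ≤ lam p) (i : Fin n) :
    e2 lam Finset.univ ≤ (32 * D ^ 3 + (8 * D / m + 4 * (M + D)))
        * (e2 lam (Finset.univ.erase i) * (K + 1 + lam i) ^ 2) ∧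
      e2 lam (Finset.univ.erase i) * (K + 1 + lam i) ^ 2
        ≤ (32 * D ^ 3 + (8 * D / m + 4 * (M + D))) * e2 lam Finset.univ := by
  have hB1 : 1 ≤ B := by linarith
  obtain ⟨hD1, hBD⟩ := one_le_and_le_cube (n := n) hB1
  rw [← hD] at hD1 hBD
  have hD0 : 0 ≤ D := by linarith
  have h3 : 0 < e3 lam Finset.univ := hm.trans_le hσm
  have hp1 := e1_erase_pos h1 h2 (Finset.mem_univ p)
  have hp2 := e2_erase_pos h1 h2 h3 (Finset.mem_univ p)
  have hs1 := one_le_e1 hp1 hp2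
  have hF := e2_erase_pos h1 h2 h3 (Finset.mem_univ i)
  have hY : 0 ≤ e2 lam (Finset.univ.erase i) * (K + 1 + lam i) ^ 2 := by positivity
  have hC1 : 0 ≤ 32 * D ^ 3 := by positivity
  have hC2 : 0 ≤ 8 * D / m + 4 * (M + D) := by positivity
  by_cases hip : i = p
  · subst hip
    obtain ⟨v1, v2, v3⟩ := abs_e_le (S := Finset.univ.erase i) hB1
      fun j hj => h j (Finset.ne_of_mem_erase hj)
    rw [← hD] at v1 v2 v3
    have hF3 := e3_le_mul_e2_erase h1 h2 h3 (Finset.mem_univ i)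
    rw [e1_eq_erase (Finset.mem_univ i)] at hF3
    rw [e3_eq_erase (Finset.mem_univ i)] at hσM
    obtain ⟨c1, c2⟩ := comparable_one_large_self hD1 hK (hB.trans hBD) hm hL v1 v2 v3 hs1 hp2
      (hσm.trans hF3) hM hσM
    rw [← e2_eq_erase (Finset.mem_univ i)] at c1 c2
    have hle := le_add_of_nonneg_left (a := 8 * D / m + 4 * (M + D))
      hC1
    exact ⟨c1.trans (mul_le_mul_of_nonneg_right hle hY),
      c2.trans (mul_le_mul_of_nonneg_right hle h2.le)⟩
  · have hi : i ∈ Finset.univ.erase p := Finset.mem_erase.2 ⟨hip, Finset.mem_univ i⟩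
    have hp : p ∈ Finset.univ.erase i := Finset.mem_erase.2 ⟨Ne.symm hip, Finset.mem_univ p⟩
    have hcomm : (Finset.univ.erase i).erase p = (Finset.univ.erase p).erase i :=
      Finset.erase_right_comm
    obtain ⟨v1, v2, -⟩ := abs_e_le (S := (Finset.univ.erase p).erase i) hB1
      fun j hj => h j (Finset.ne_of_mem_erase (Finset.mem_of_mem_erase hj))
    rw [← hD] at v1 v2
    have ht := e1_erase_pos hp1 hp2 hi
    rw [e1_eq_erase hi] at hs1
    rw [e2_eq_erase hi] at hp2
    obtain ⟨c1, c2⟩ := comparable_one_large_of_bounded hD1 hK (hB.trans hBD) hL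
      ((h i hip).trans hBD) (hlam i) v1 v2 ht two_mul_e2_le hs1 hp2
    rw [← e1_eq_erase hi, ← e2_eq_erase hi, ← e2_eq_erase (Finset.mem_univ p), ← hcomm,
      ← e2_eq_erase hp] at c1 c2
    have hle := le_add_of_nonneg_right (a := 32 * D ^ 3) hC2
    exact ⟨c1.trans (mul_le_mul_of_nonneg_right hle hY),
      c2.trans (mul_le_mul_of_nonneg_right hle h2.le)⟩

lemma comparable_of_two_large (hK : 0 < K) (hM : 0 ≤ M)
    (h1 : 0 < e1 lam Finset.univ) (h2 : 0 < e2 lam Finset.univ) (h3 : 0 < e3 lam Finset.univ)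
    (hσM : e3 lam Finset.univ ≤ M) (hlam : ∀ j, -K ≤ lam j) {p q : Fin n} (hqp : q ≠ p)
    (hmax : ∀ j, j ≠ p → lam j ≤ lam q) (hle : lam q ≤ lam p)
    {A D : ℝ} (hA : A = 4 * (1 + (n + 1) * (K + 1)) ^ 3) (hD : D = ((n + 1) * (A + 1)) ^ 3)
    (hR : 20 * A + 4 * A ^ 2 + 20 * D + 5 * M + K + 1 ≤ lam q) (i : Fin n) :
    e2 lam Finset.univ
        ≤ 24 * D ^ 2 * (e2 lam (Finset.univ.erase i) * (K + 1 + lam i) ^ 2) ∧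
      e2 lam (Finset.univ.erase i) * (K + 1 + lam i) ^ 2
        ≤ 24 * D ^ 2 * e2 lam Finset.univ := by
  have hn0 : (0 : ℝ) ≤ n := Nat.cast_nonneg n
  have hnK : 0 ≤ n * K := by positivity
  have hA0 : 1 + (n + 1) * (K + 1) ≤ A := by
    rw [hA]
    have : 1 + (n + 1) * (K + 1) ≤ (1 + (n + 1) * (K + 1)) ^ 3 :=
      le_self_pow₀ (by nlinarith) three_ne_zero
    nlinarith
  have hA1 : 1 ≤ A := by nlinarith
  have hAn : (n : ℝ) + 1 ≤ A := by nlinarith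
  have hAK : K + 1 ≤ A := by nlinarith
  obtain ⟨hD1, hAD⟩ := one_le_and_le_cube (n := n) (B := A + 1) (by linarith)
  rw [← hD] at hD1 hAD
  have hA2 : 0 ≤ A ^ 2 := sq_nonneg A
  set T := (Finset.univ.erase p).erase q with hT
  have hq : q ∈ Finset.univ.erase p := Finset.mem_erase.2 ⟨hqp, Finset.mem_univ q⟩
  have hp : p ∈ Finset.univ.erase q := Finset.mem_erase.2 ⟨hqp.symm, Finset.mem_univ p⟩
  have hcomm : (Finset.univ.erase q).erase p = T := Finset.erase_right_comm
  have hp1 := e1_erase_pos h1 h2 (Finset.mem_univ p)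
  have hp2 := e2_erase_pos h1 h2 h3 (Finset.mem_univ p)
  have ht : 0 < e1 lam T := e1_erase_pos hp1 hp2 hq
  obtain ⟨w1, w2, w3⟩ := semiconvex_bounds hK hlam ht hA
  have hE1p : e1 lam (Finset.univ.erase p) = lam q + e1 lam T := e1_eq_erase hq
  have hE2p : e2 lam (Finset.univ.erase p) = lam q * e1 lam T + e2 lam T := e2_eq_erase hq
  have hE3p : e3 lam (Finset.univ.erase p) = lam q * e2 lam T + e3 lam T := e3_eq_erase hq
  have hE2q : e2 lam (Finset.univ.erase q) = lam p * e1 lam T + e2 lam T := by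
    rw [e2_eq_erase hp, hcomm]
  have hE1 := e1_eq_erase (lam := lam) (Finset.mem_univ p)
  have hE2 := e2_eq_erase (lam := lam) (Finset.mem_univ p)
  have hE3 := e3_eq_erase (lam := lam) (Finset.mem_univ p)
  rw [hE1p] at hE1
  rw [hE1p, hE2p] at hE2
  rw [hE2p, hE3p] at hE3
  have hσ : e2 lam Finset.univ = lam p * lam q + (lam p + lam q) * e1 lam T + e2 lam T := by
    rw [hE2]
    ring
  have hq0 : 0 < lam q := by linarith
  have htq : e1 lam T ≤ A * lam q := by
    refine (e1_le_mul (by linarith) fun j hj =>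
      hmax j (Finset.ne_of_mem_erase (Finset.mem_of_mem_erase hj))).trans ?_
    gcongr
  have hqt : lam q * e1 lam T ≤ 2 * M + 6 * A :=
    mul_le_of_two_large hA1 hM hle (by linarith) (by linarith) ht htq w2 w3 (hE3 ▸ hσM)
  have ht' : e1 lam T ≤ 1 / 2 := by
    refine le_of_mul_le_mul_left (hqt.trans ?_) hq0
    linarith
  have hTB : ∀ j ∈ T, |lam j| ≤ A + 1 := fun j hj => by
    rw [abs_le]
    constructor
    · linarith [hlam j]
    · linarith [w1 j hj]
  obtain ⟨-, v2, v3⟩ := abs_e_le (S := T) (by linarith) hTB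
  rw [← hD] at v2 v3
  have ht2 : e2 lam T ≤ -(1 / 4) := by
    have := two_mul_e2_le (lam := lam) (S := T)
    have := pow_le_pow_left₀ ht.le ht' 2
    linarith
  have hσ0 := h3.le
  rw [hE3] at hσM hσ0
  by_cases hip : i = p
  · subst hip
    rw [hσ, hE2p]
    exact comparable_two_large_of_large hD1 hM hK (by linarith) (by linarith) ht ht' ht2
      (abs_le.1 v2).1 v3 hσ0 hσM
  by_cases hiq : i = q
  · subst hiq
    have hσ' : e2 lam Finset.univ = lam i * lam p + (lam i + lam p) * e1 lam T + e2 lam T := by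
      rw [hσ]
      ring
    rw [hσ', hE2q]
    refine comparable_two_large_of_large hD1 hM hK (by linarith) (by linarith) ht ht' ht2
      (abs_le.1 v2).1 v3 ?_ ?_
    · linarith
    · linarith
  · have hiT : i ∈ T :=
      Finset.mem_erase.2 ⟨hiq, Finset.mem_erase.2 ⟨hip, Finset.mem_univ i⟩⟩
    have hFi : e2 lam (Finset.univ.erase i)
        = e2 lam Finset.univ - lam i * (lam p + lam q + e1 lam T - lam i) := by
      have e1i := e1_eq_erase (lam := lam) (Finset.mem_univ i)
      have e2i := e2_eq_erase (lam := lam) (Finset.mem_univ i)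
      have : e1 lam (Finset.univ.erase i) = lam p + lam q + e1 lam T - lam i := by linarith
      rw [this] at e2i
      linarith
    rw [hFi]
    exact comparable_two_large_of_bounded hD1 hK hM (by linarith) (by linarith) hle ht ht'
      (by linarith) (abs_le.1 v2).1 ((hTB i hiT).trans hAD) (hlam i) hσ

end Comparability

/-- Uniform ellipticity after the Legendre–Lewy transform (with `K₁ = K+1`):
`F^{ii}(λ)(K+1+λ_i)² ∼ σ₂(λ) + σ₁(λ)` on `Γ̃₃`, uniformly for `λ ≥ -K` and
`m ≤ σ₃(λ)+σ₂(λ) ≤ M`. -/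
theorem uniform_ellipticity_legendre_lewy
    (n : ℕ) (hn : 3 ≤ n) (K m M : ℝ) (hK : 0 < K) (hm : 0 < m) (hmM : m ≤ M) :
    ∃ C : ℝ, 0 < C ∧
      ∀ lam : Fin n → ℝ, lam ∈ GammaTilde3 n →
        (∀ i : Fin n, -K ≤ lam i) →
        m ≤ esymm n 3 lam + esymm n 2 lam →
        esymm n 3 lam + esymm n 2 lam ≤ M →
        ∀ i : Fin n,
          C⁻¹ * (esymm n 2 lam + esymm n 1 lam) ≤ Fii n lam i * (K + 1 + lam i) ^ 2 ∧
          Fii n lam i * (K + 1 + lam i) ^ 2 ≤ C * (esymm n 2 lam + esymm n 1 lam) := by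
  obtain ⟨A, hA⟩ : ∃ A : ℝ, A = 4 * (1 + (n + 1) * (K + 1)) ^ 3 := ⟨_, rfl⟩
  obtain ⟨D₂, hD₂⟩ : ∃ D : ℝ, D = ((n + 1) * (A + 1)) ^ 3 := ⟨_, rfl⟩
  obtain ⟨R, hR⟩ : ∃ R : ℝ, R = 20 * A + 4 * A ^ 2 + 20 * D₂ + 5 * M + K + 1 := ⟨_, rfl⟩
  obtain ⟨D₁, hD₁⟩ : ∃ D : ℝ, D = ((n + 1) * R) ^ 3 := ⟨_, rfl⟩
  obtain ⟨B, hB⟩ : ∃ B : ℝ, B = 16 * D₁ ^ 2 + R := ⟨_, rfl⟩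
  obtain ⟨D₀, hD₀⟩ : ∃ D : ℝ, D = ((n + 1) * B) ^ 3 := ⟨_, rfl⟩
  have hM : 0 ≤ M := hm.le.trans hmM
  have hA0 : 0 < A := by rw [hA]; positivity
  have hD₂0 : 0 < D₂ := by rw [hD₂]; positivity
  have hR0 : K + 1 ≤ R := by rw [hR]; linarith [sq_nonneg A]
  have hRpos : 0 < R := by linarith
  have hD₁0 : 0 < D₁ := by rw [hD₁]; positivity
  have hBR : R ≤ B := by rw [hB]; linarith [sq_nonneg D₁]
  have hC₀ : 0 ≤ 4 * D₀ ^ 4 / m := by positivity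
  have hC₁ : 0 ≤ 32 * D₁ ^ 3 + (8 * D₁ / m + 4 * (M + D₁)) := by positivity
  have hC₂ : 0 < 24 * D₂ ^ 2 := by positivity
  obtain ⟨C, hC⟩ : ∃ C : ℝ,
      C = 4 * D₀ ^ 4 / m + (32 * D₁ ^ 3 + (8 * D₁ / m + 4 * (M + D₁))) + 24 * D₂ ^ 2 := ⟨_, rfl⟩
  have hCpos : 0 < C := by linarith
  refine ⟨C, hCpos, fun lam hΓ hlam hσm hσM i => ?_⟩
  have h1 : 0 < e1 lam Finset.univ := by
    rw [e1_univ]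
    linarith [hΓ.1 1 le_rfl one_le_two]
  have h2 : 0 < e2 lam Finset.univ := by
    rw [e2_univ]
    linarith [hΓ.1 1 le_rfl one_le_two, hΓ.1 2 one_le_two le_rfl]
  rw [← e3_univ] at hσm hσM
  rw [← e2_univ, Fii_eq_e2, inv_mul_le_iff₀ hCpos]
  have h3 : 0 < e3 lam Finset.univ := hm.trans_le hσm
  have hF := e2_erase_pos h1 h2 h3 (Finset.mem_univ i)
  have hY : 0 ≤ e2 lam (Finset.univ.erase i) * (K + 1 + lam i) ^ 2 := by positivity
  suffices H : ∃ c ≤ C,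
      e2 lam Finset.univ ≤ c * (e2 lam (Finset.univ.erase i) * (K + 1 + lam i) ^ 2) ∧
      e2 lam (Finset.univ.erase i) * (K + 1 + lam i) ^ 2 ≤ c * e2 lam Finset.univ by
    obtain ⟨c, hc, c1, c2⟩ := H
    exact ⟨c1.trans (mul_le_mul_of_nonneg_right hc hY),
      c2.trans (mul_le_mul_of_nonneg_right hc h2.le)⟩
  obtain ⟨p, -, hpmax⟩ := Finset.exists_max_image Finset.univ lam ⟨i, Finset.mem_univ i⟩
  have hne : (Finset.univ.erase p).Nonempty := by
    rw [← Finset.card_pos, Finset.card_erase_of_mem (Finset.mem_univ p), Finset.card_fin]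
    omega
  obtain ⟨q, hq, hqmax⟩ := Finset.exists_max_image (Finset.univ.erase p) lam hne
  have hmax : ∀ j, j ≠ p → lam j ≤ lam q := fun j hj =>
    hqmax j (Finset.mem_erase.2 ⟨hj, Finset.mem_univ j⟩)
  rcases le_total R (lam q) with hqR | hqR
  · exact ⟨24 * D₂ ^ 2, by linarith,
      comparable_of_two_large hK hM h1 h2 h3 hσM hlam (Finset.ne_of_mem_erase hq) hmax
        (hpmax q (Finset.mem_univ q)) hA hD₂ (hR ▸ hqR) i⟩
  · have habs : ∀ j, j ≠ p → |lam j| ≤ R := fun j hj =>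
      abs_le.2 ⟨by linarith [hlam j], (hmax j hj).trans hqR⟩
    rcases le_total (16 * D₁ ^ 2) (lam p) with hpR | hpR
    · exact ⟨_, by linarith,
        comparable_of_forall_ne_abs_le hK hm hM h1 h2 hσm hσM hlam hR0 habs hD₁ hpR i⟩
    · refine ⟨_, by linarith,
        comparable_of_forall_abs_le hK hm h1 h2 hσm hlam (hR0.trans hBR) (fun j => ?_) hD₀ i⟩
      by_cases hj : j = p
      · rw [hj, abs_le]
        constructor
        · linarith [hlam p]
        · linarith
      · exact (habs j hj).trans hBR
end
end

section
/- Let n ≥ 3, K > 0 and 0 < m ≤ M. There exists a constant C > 0, depending only on n, K, m and M, such that for every λ ∈ Γ̃₃ with λ_i ≥ -K for all i and m ≤ σ₃(λ) + σ₂(λ) ≤ M, and for every vector a = (a₁, …, a_n) ∈ ℝⁿ: Σ_{i=1}^{n} |a_i · σ₁(λ|i)| ≤ C Σ_{i=1}^{n} F^{ii}(λ) a_i² + C (σ₂(λ) + σ₁(λ)). -/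
open scoped BigOperators
noncomputable section

theorem sum_powersetCard_one_prod {ι : Type*} [DecidableEq ι] (f : ι → ℝ) (S : Finset ι) :
    ∑ s ∈ S.powersetCard 1, ∏ j ∈ s, f j = ∑ j ∈ S, f j := by
  simp [Finset.powersetCard_one]

theorem sum_powersetCard_succ_insert_prod {ι : Type*} [DecidableEq ι] (f : ι → ℝ) (S : Finset ι)
    {i : ι} (hi : i ∉ S) (k : ℕ) :
    ∑ s ∈ (insert i S).powersetCard (k + 1), ∏ j ∈ s, f j =
      ∑ s ∈ S.powersetCard (k + 1), ∏ j ∈ s, f j +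
        f i * ∑ s ∈ S.powersetCard k, ∏ j ∈ s, f j := by
  have hmem : ∀ s ∈ S.powersetCard k, i ∉ s := fun _ hs h =>
    hi ((Finset.mem_powersetCard.mp hs).1 h)
  rw [Finset.powersetCard_succ_insert hi, Finset.sum_union, Finset.sum_image, Finset.mul_sum]
  · congr 1
    exact Finset.sum_congr rfl fun s hs => Finset.prod_insert (hmem s hs)
  · intro s hs t ht hst
    rw [← Finset.erase_insert (hmem s hs), ← Finset.erase_insert (hmem t ht), hst]
  · rw [Finset.disjoint_left]
    intro s hs hs'
    obtain ⟨t, -, rfl⟩ := Finset.mem_image.mp hs'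
    exact hi ((Finset.mem_powersetCard.mp hs).1 (Finset.mem_insert_self i t))

theorem sum_powersetCard_two_prod {ι : Type*} [DecidableEq ι] (f : ι → ℝ) (S : Finset ι) :
    ∑ s ∈ S.powersetCard 2, ∏ j ∈ s, f j =
      ((∑ j ∈ S, f j) ^ 2 - ∑ j ∈ S, f j ^ 2) / 2 := by
  induction S using Finset.induction_on with
  | empty =>
    simp [Finset.powersetCard_eq_empty.mpr (Finset.card_empty.trans_lt (Nat.succ_pos _))]
  | insert i S hi ih =>
    rw [sum_powersetCard_succ_insert_prod f S hi 1, ih, sum_powersetCard_one_prod,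
      Finset.sum_insert hi, Finset.sum_insert hi]
    ring

theorem sum_powersetCard_three_prod {ι : Type*} [DecidableEq ι] (f : ι → ℝ) (S : Finset ι) :
    ∑ s ∈ S.powersetCard 3, ∏ j ∈ s, f j =
      ((∑ j ∈ S, f j) ^ 3 - 3 * (∑ j ∈ S, f j) * ∑ j ∈ S, f j ^ 2
        + 2 * ∑ j ∈ S, f j ^ 3) / 6 := by
  induction S using Finset.induction_on with
  | empty =>
    simp [Finset.powersetCard_eq_empty.mpr (Finset.card_empty.trans_lt (Nat.succ_pos _))]
  | insert i S hi ih =>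
    rw [sum_powersetCard_succ_insert_prod f S hi 2, ih, sum_powersetCard_two_prod,
      Finset.sum_insert hi, Finset.sum_insert hi, Finset.sum_insert hi]
    ring

/-- Newton's inequality `3 σ₁ σ₃ ≤ 2 σ₂²` in terms of power sums, for the entries `f j` (`j ∈ S`)
together with an additional entry `1`. -/
theorem newton_powerSum_adjoin_one {ι : Type*} (f : ι → ℝ) (S : Finset ι) :
    0 ≤ (1 + ∑ j ∈ S, f j ^ 2) ^ 2 + (1 + ∑ j ∈ S, f j) ^ 2 * (1 + ∑ j ∈ S, f j ^ 2)
      - 2 * (1 + ∑ j ∈ S, f j) * (1 + ∑ j ∈ S, f j ^ 3) := by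
  set A := ∑ j ∈ S, f j
  set B := ∑ j ∈ S, f j ^ 2 with hB
  have hB0 : 0 ≤ B := Finset.sum_nonneg fun j _ => sq_nonneg _
  have key : 0 ≤ ∑ j ∈ S, f j ^ 2 * ((1 + B) + (1 + A) ^ 2 - 2 * (1 + A) * f j) := by
    refine Finset.sum_nonneg fun j hj => mul_nonneg (sq_nonneg _) ?_
    have : f j ^ 2 ≤ B :=
      Finset.single_le_sum (f := fun j => f j ^ 2) (fun j _ => sq_nonneg _) hj
    nlinarith [sq_nonneg (1 + A - f j)]
  have expand : ∑ j ∈ S, f j ^ 2 * ((1 + B) + (1 + A) ^ 2 - 2 * (1 + A) * f j) =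
      B * ((1 + B) + (1 + A) ^ 2) - 2 * (1 + A) * ∑ j ∈ S, f j ^ 3 := by
    rw [hB, Finset.sum_mul, Finset.mul_sum, ← Finset.sum_sub_distrib]
    exact Finset.sum_congr rfl fun j _ => by ring
  rw [expand] at key
  nlinarith [sq_nonneg A]

/-- Lower bound for `σ₂` of a vector with largest entry `y ≥ 1` and remaining entries of power sums
`p`, `q`, `r`, under a lower bound for `x σ₂ + σ₃`. -/
theorem sigma_two_lower_bound {N x y p q r e : ℝ} (hN : 1 ≤ N) (hy : 1 ≤ y) (hp : 0 < p)
    (hpN : p ≤ N * y) (hq : 1 ≤ q) (hr : r ≤ y * q) (he : e = y * p + (p ^ 2 - q) / 2)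
    (he0 : 0 < e)
    (hf : 0 < x * e + y * (p ^ 2 - q) / 2 + (p ^ 3 - 3 * p * q + 2 * r) / 6) :
    y ≤ 18 * (x * e) ∨ y ≤ 18 * N * e := by
  rcases le_or_gt (8 * p ^ 2) q with hpq | hpq
  · left
    have h1 : p * p ^ 2 ≤ p * q := mul_le_mul_of_nonneg_left (by nlinarith) hp.le
    have h2 : y * (8 * p ^ 2) ≤ y * q := mul_le_mul_of_nonneg_left hpq (by linarith)
    have h3 : y * 1 ≤ y * q := mul_le_mul_of_nonneg_left hq (by linarith)
    have h4 : 0 < p * q := by positivity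
    nlinarith
  · have hp3 : 1 / 3 ≤ p := by nlinarith
    have hy0 : 0 < y := by linarith
    have hNy : y ≤ N * y := le_mul_of_one_le_left hy0.le hN
    have h0 : y ^ 2 * p / 3 ≤ e * (x + y / 3 + p / 3) := by
      have hq' : q = p ^ 2 + 2 * y * p - 2 * e := by rw [he]; ring
      have h4 : 0 < p * q := by positivity
      rw [hq'] at hf hr h4
      nlinarith
    have h1 : y ^ 2 / 9 ≤ e * (x + N * y) := by
      have h2 : y ^ 2 * (1 / 3) ≤ y ^ 2 * p := mul_le_mul_of_nonneg_left hp3 (sq_nonneg y)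
      have h3 : e * (x + y / 3 + p / 3) ≤ e * (x + N * y) :=
        mul_le_mul_of_nonneg_left (by linarith) he0.le
      linarith
    rcases le_or_gt x (N * y) with hx | hx
    · right
      have h3 : e * (x + N * y) ≤ e * (2 * (N * y)) :=
        mul_le_mul_of_nonneg_left (by linarith) he0.le
      have : y * y ≤ y * (18 * N * e) := by nlinarith
      exact le_of_mul_le_mul_left this hy0
    · left
      have h3 : e * (x + N * y) ≤ e * (2 * x) :=
        mul_le_mul_of_nonneg_left (by linarith) he0.le
      nlinarith

theorem mul_le_add_of_sq_le {D a s e T : ℝ} (hD : 0 ≤ D) (he : 0 ≤ e) (hT : 0 ≤ T)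
    (h : s ^ 2 ≤ D * (e * T)) : |a * s| ≤ D * (e * a ^ 2) + T := by
  have h0 : 0 ≤ D * (e * a ^ 2) := by positivity
  refine abs_le_of_sq_le_sq ?_ (by positivity)
  have h1 : a ^ 2 * s ^ 2 ≤ a ^ 2 * (D * (e * T)) := mul_le_mul_of_nonneg_left h (sq_nonneg a)
  nlinarith [sq_nonneg (D * (e * a ^ 2) - T), mul_nonneg h0 hT]

theorem sum_erase_powerSum_bounds {n : ℕ} (hn : 2 ≤ n) (lam : Fin n → ℝ) (i : Fin n) :
    (∑ k ∈ Finset.univ.erase i, lam k ≤ n) ∨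
    ∃ y p q r : ℝ, 1 ≤ y ∧ p ≤ n * y ∧ 1 ≤ q ∧ r ≤ y * q ∧
      1 + ∑ k ∈ Finset.univ.erase i, lam k = y + p ∧
      1 + ∑ k ∈ Finset.univ.erase i, lam k ^ 2 = y ^ 2 + q ∧
      1 + ∑ k ∈ Finset.univ.erase i, lam k ^ 3 = y ^ 3 + r ∧
      ∑ k ∈ Finset.univ.erase i, lam k ≤ n * y := by
  have hcard : (Finset.univ.erase i).card = n - 1 := by simp
  have hne : (Finset.univ.erase i).Nonempty := Finset.card_pos.mp (by omega)
  obtain ⟨j, hj, hmax⟩ := Finset.exists_max_image _ lam hne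
  have hsum : ∑ k ∈ Finset.univ.erase i, lam k ≤ (n - 1) * lam j := by
    have := Finset.sum_le_card_nsmul _ lam _ hmax
    rwa [hcard, nsmul_eq_mul, Nat.cast_sub (by omega), Nat.cast_one] at this
  have hn' : (2 : ℝ) ≤ n := by exact_mod_cast hn
  rcases le_or_gt (lam j) 1 with hj1 | hj1
  · left
    nlinarith
  · right
    have hS (f : Fin n → ℝ) := Finset.add_sum_erase _ f hj
    have h1 := hS lam
    have h2 := hS fun k => lam k ^ 2
    have h3 := hS fun k => lam k ^ 3
    refine ⟨lam j, 1 + ∑ k ∈ (Finset.univ.erase i).erase j, lam k,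
      1 + ∑ k ∈ (Finset.univ.erase i).erase j, lam k ^ 2,
      1 + ∑ k ∈ (Finset.univ.erase i).erase j, lam k ^ 3, hj1.le, by nlinarith, ?_, ?_,
      by linarith, by linarith, by linarith, by nlinarith⟩
    · linarith [Finset.sum_nonneg fun k (_ : k ∈ (Finset.univ.erase i).erase j) =>
        sq_nonneg (lam k)]
    · have : ∑ k ∈ (Finset.univ.erase i).erase j, lam k ^ 3 ≤
          lam j * ∑ k ∈ (Finset.univ.erase i).erase j, lam k ^ 2 := by
        rw [Finset.mul_sum]
        refine Finset.sum_le_sum fun k hk => ?_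
        rw [pow_succ' (lam k) 2]
        exact mul_le_mul_of_nonneg_right (hmax k (Finset.mem_of_mem_erase hk)) (sq_nonneg _)
      linarith

theorem esymmErase_one_sq_le {n : ℕ} (hn : 2 ≤ n) {m : ℝ} (hm : 0 < m) {lam : Fin n → ℝ}
    (hlam : lam ∈ GammaCone n 2) (hf : m ≤ esymm n 3 lam + esymm n 2 lam) (i : Fin n) :
    0 < Fii n lam i ∧
      esymmErase n 1 lam i ^ 2 ≤
        (n / m + 18 * n + 972 * n ^ 4) * (Fii n lam i * (esymm n 2 lam + esymm n 1 lam)) := by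
  have hs1 : 0 < esymm n 1 lam := hlam 1 le_rfl (by norm_num)
  have hs2 : 0 < esymm n 2 lam := hlam 2 (by norm_num) le_rfl
  have hsplit (f : Fin n → ℝ) := Finset.add_sum_erase Finset.univ f (Finset.mem_univ i)
  have hnewton := newton_powerSum_adjoin_one lam (Finset.univ.erase i)
  have hbounds := sum_erase_powerSum_bounds hn lam i
  have hB0 : 0 ≤ ∑ k ∈ Finset.univ.erase i, lam k ^ 2 :=
    Finset.sum_nonneg fun k _ => sq_nonneg _
  simp only [esymm, esymmErase, Fii, sum_powersetCard_one_prod, sum_powersetCard_two_prod,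
    sum_powersetCard_three_prod, ← hsplit lam, ← hsplit fun k => lam k ^ 2,
    ← hsplit fun k => lam k ^ 3] at hs1 hs2 hf ⊢
  generalize ∑ k ∈ Finset.univ.erase i, lam k = A at *
  generalize ∑ k ∈ Finset.univ.erase i, lam k ^ 2 = B at *
  generalize ∑ k ∈ Finset.univ.erase i, lam k ^ 3 = D at *
  generalize lam i = x at *
  have hn' : (2 : ℝ) ≤ n := by exact_mod_cast hn
  generalize (n : ℝ) = N at *
  have hA : 0 < A := by nlinarith
  obtain ⟨e, he⟩ : ∃ e, e = (A ^ 2 - B) / 2 + A := ⟨_, rfl⟩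
  obtain ⟨T, hT⟩ : ∃ T, T = ((x + A) ^ 2 - (x ^ 2 + B)) / 2 + (x + A) := ⟨_, rfl⟩
  have hT0 : 0 < T := by rw [hT]; positivity
  have hTe : T = x * (A + 1) + e := by rw [hT, he]; ring
  have hf' : m ≤ x * e + ((1 + A) ^ 3 - 3 * (1 + A) * (1 + B) + 2 * (1 + D)) / 6 := by
    rw [he]; linarith
  rw [← he, ← hT]
  have hlower : e ^ 2 / 3 + (A + 1) * m ≤ e * T := by
    have h1 := mul_le_mul_of_nonneg_left hf' (by linarith : 0 ≤ A + 1)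
    have h2 : e = ((1 + A) ^ 2 - (1 + B)) / 2 := by rw [he]; ring
    have h3 : 3 / 2 * ((A + 1) *
        (((1 + A) ^ 3 - 3 * (1 + A) * (1 + B) + 2 * (1 + D)) / 6)) ≤ e ^ 2 := by
      rw [h2]; linarith
    rw [hTe]
    linarith
  have heT : 0 < e * T := lt_of_lt_of_le (by positivity) hlower
  have he0 : 0 < e := pos_of_mul_pos_left heT hT0.le
  have hAm : A * m ≤ e * T := by nlinarith [sq_nonneg e]
  have h1 : 0 ≤ N / m * (e * T) := by positivity
  have h2 : 0 ≤ 18 * N * (e * T) := by positivity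
  have h3 : 0 ≤ 972 * N ^ 4 * (e * T) := by positivity
  refine ⟨he0, ?_⟩
  rcases hbounds with hAN | ⟨y, p, q, r, hy, hpN, hq, hr, hyp, hyq, hyr, hAy⟩
  · have : A ^ 2 ≤ N / m * (e * T) := by
      rw [div_mul_eq_mul_div, le_div_iff₀ hm]
      nlinarith
    linarith
  · have hp : 0 < p := by nlinarith
    have hey : e = y * p + (p ^ 2 - q) / 2 := by
      have : e = ((1 + A) ^ 2 - (1 + B)) / 2 := by rw [he]; ring
      rw [this, hyp, hyq]; ring
    have hfy : 0 < x * e + y * (p ^ 2 - q) / 2 + (p ^ 3 - 3 * p * q + 2 * r) / 6 := by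
      rw [hyp, hyq, hyr] at hf'
      linarith
    have hA2 : A * A ≤ A * (N * y) := mul_le_mul_of_nonneg_left hAy hA.le
    have hNA : 0 < N * A := by positivity
    rcases sigma_two_lower_bound (by linarith) hy hp hpN hq hr hey he0 hfy with hc | hc
    · have h4 : N * A * y ≤ N * A * (18 * (x * e)) := mul_le_mul_of_nonneg_left hc hNA.le
      have h5 : A * (x * e) ≤ e * T := by
        have : 0 ≤ x * e := by linarith
        rw [hTe]
        linarith [sq_nonneg e]
      have h6 := mul_le_mul_of_nonneg_left h5 (by linarith : 0 ≤ 18 * N)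
      linarith
    · have h4 : A ≤ 18 * N ^ 2 * e := by
        have := mul_le_mul_of_nonneg_left hc (by linarith : 0 ≤ N)
        linarith
      have h5 : A ^ 2 ≤ (18 * N ^ 2 * e) ^ 2 := pow_le_pow_left₀ hA.le h4 2
      have h6 : e ^ 2 / 3 ≤ e * T := by
        have : 0 < (A + 1) * m := by positivity
        linarith
      have h7 := mul_le_mul_of_nonneg_left h6 (by positivity : 0 ≤ 972 * N ^ 4)
      linarith

/-- The key lemma: `Σ_i |a_i σ₁(λ|i)| ≤ C Σ_i F^{ii} a_i² + C(σ₂(λ) + σ₁(λ))`. -/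
theorem key_lemma_sigma2_Fii_comparable
    (n : ℕ) (hn : 3 ≤ n) (K m M : ℝ) (hK : 0 < K) (hm : 0 < m) (hmM : m ≤ M) :
    ∃ C : ℝ, 0 < C ∧
      ∀ lam : Fin n → ℝ, lam ∈ GammaTilde3 n →
        (∀ i : Fin n, -K ≤ lam i) →
        m ≤ esymm n 3 lam + esymm n 2 lam →
        esymm n 3 lam + esymm n 2 lam ≤ M →
        ∀ a : Fin n → ℝ,
          ∑ i : Fin n, |a i * esymmErase n 1 lam i| ≤
            C * ∑ i : Fin n, Fii n lam i * a i ^ 2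
            + C * (esymm n 2 lam + esymm n 1 lam) := by
  have hn0 : (0 : ℝ) < n := by exact_mod_cast (by omega : 0 < n)
  obtain ⟨D, hD⟩ : ∃ D : ℝ, D = n / m + 18 * n + 972 * n ^ 4 := ⟨_, rfl⟩
  have hD0 : 0 < D := by rw [hD]; positivity
  refine ⟨D + n, by positivity, fun lam hlam _ hf _ a => ?_⟩
  have hT : 0 < esymm n 2 lam + esymm n 1 lam :=
    add_pos (hlam.1 2 (by norm_num) le_rfl) (hlam.1 1 le_rfl (by norm_num))
  have hlem := esymmErase_one_sq_le (by omega) hm hlam.1 hf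
  have hsum : 0 ≤ ∑ i : Fin n, Fii n lam i * a i ^ 2 :=
    Finset.sum_nonneg fun i _ => mul_nonneg (hlem i).1.le (sq_nonneg _)
  calc ∑ i : Fin n, |a i * esymmErase n 1 lam i|
      ≤ ∑ i : Fin n, (D * (Fii n lam i * a i ^ 2) + (esymm n 2 lam + esymm n 1 lam)) := by
        refine Finset.sum_le_sum fun i _ => ?_
        obtain ⟨h2, h3⟩ := hlem i
        exact mul_le_add_of_sq_le hD0.le h2.le hT.le (hD ▸ h3)
    _ = D * ∑ i : Fin n, Fii n lam i * a i ^ 2 + n * (esymm n 2 lam + esymm n 1 lam) := by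
        rw [Finset.sum_add_distrib, ← Finset.mul_sum]
        simp [mul_add]
    _ ≤ (D + n) * ∑ i : Fin n, Fii n lam i * a i ^ 2
          + (D + n) * (esymm n 2 lam + esymm n 1 lam) := by
        nlinarith [mul_nonneg hn0.le hsum, mul_nonneg hD0.le hT.le]
end
end

section
/- Let n ≥ 3, let a = (12/(n(n-1)(n-2)))^{1/3} and C₀ = (n-2)a/2 (equivalently C₀ = (3(n-2)²/(2n(n-1)))^{1/3}). Then for every μ ∈ ℝⁿ, denoting by 𝟙 = (1,…,1) ∈ ℝⁿ: σ₃(μ + a·𝟙) - C₀·σ₂(μ + a·𝟙) = σ₃(μ) + ((n-2)a/2)·σ₂(μ) - 1. In particular, if u solves σ₃(D²u) = C₀·σ₂(D²u), then v = u - (a/2)|x|² solves σ₃(D²v) + ((n-2)a/2)·σ₂(D²v) = 1. -/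
open scoped BigOperators
noncomputable section

theorem sum_powersetCard_succ_empty_prod {ι : Type*} (k : ℕ) (f : ι → ℝ) :
    ∑ t ∈ (∅ : Finset ι).powersetCard (k + 1), ∏ i ∈ t, f i = 0 := by
  rw [Finset.powersetCard_eq_empty.2 (by simp), Finset.sum_empty]

theorem sum_powersetCard_insert_prod {ι : Type*} [DecidableEq ι] {s : Finset ι} {x : ι}
    (hx : x ∉ s) (k : ℕ) (f : ι → ℝ) :
    ∑ t ∈ (insert x s).powersetCard (k + 1), ∏ i ∈ t, f i =
      ∑ t ∈ s.powersetCard (k + 1), ∏ i ∈ t, f i +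
        f x * ∑ t ∈ s.powersetCard k, ∏ i ∈ t, f i := by
  have hmem : ∀ {j : ℕ} {t : Finset ι}, t ∈ s.powersetCard j → x ∉ t := fun ht hxt =>
    hx ((Finset.mem_powersetCard.1 ht).1 hxt)
  rw [Finset.powersetCard_succ_insert hx, Finset.sum_union, Finset.sum_image, Finset.mul_sum]
  · congr 1
    exact Finset.sum_congr rfl fun t ht => Finset.prod_insert (hmem ht)
  · intro t ht u hu h
    rw [← Finset.erase_insert (hmem ht), ← Finset.erase_insert (hmem hu)]
    exact congrArg (fun v => v.erase x) h
  · rw [Finset.disjoint_left]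
    intro t ht h
    obtain ⟨u, -, rfl⟩ := Finset.mem_image.1 h
    exact hmem ht (Finset.mem_insert_self x u)

theorem sum_powersetCard_one_prod_add {ι : Type*} (s : Finset ι) (f : ι → ℝ) (a : ℝ) :
    ∑ t ∈ s.powersetCard 1, ∏ i ∈ t, (f i + a) =
      ∑ t ∈ s.powersetCard 1, ∏ i ∈ t, f i + s.card * a := by
  simp [Finset.powersetCard_one, Finset.sum_add_distrib]

theorem sum_powersetCard_two_prod_add {ι : Type*} (s : Finset ι) (f : ι → ℝ) (a : ℝ) :
    ∑ t ∈ s.powersetCard 2, ∏ i ∈ t, (f i + a) =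
      ∑ t ∈ s.powersetCard 2, ∏ i ∈ t, f i +
        ((s.card : ℝ) - 1) * a * ∑ t ∈ s.powersetCard 1, ∏ i ∈ t, f i +
        (s.card : ℝ) * ((s.card : ℝ) - 1) / 2 * a ^ 2 := by
  classical
  induction s using Finset.induction_on with
  | empty => simp [sum_powersetCard_succ_empty_prod]
  | insert x s hx ih =>
    simp only [sum_powersetCard_insert_prod hx 1, sum_powersetCard_insert_prod hx 0,
      sum_powersetCard_one_prod_add, ih, Finset.card_insert_of_notMem hx, zero_add,
      Finset.powersetCard_zero, Finset.sum_singleton, Finset.prod_empty]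
    push_cast
    ring

theorem sum_powersetCard_three_prod_add {ι : Type*} (s : Finset ι) (f : ι → ℝ) (a : ℝ) :
    ∑ t ∈ s.powersetCard 3, ∏ i ∈ t, (f i + a) =
      ∑ t ∈ s.powersetCard 3, ∏ i ∈ t, f i +
        ((s.card : ℝ) - 2) * a * ∑ t ∈ s.powersetCard 2, ∏ i ∈ t, f i +
        ((s.card : ℝ) - 1) * ((s.card : ℝ) - 2) / 2 * a ^ 2 *
          ∑ t ∈ s.powersetCard 1, ∏ i ∈ t, f i +
        (s.card : ℝ) * ((s.card : ℝ) - 1) * ((s.card : ℝ) - 2) / 6 * a ^ 3 := by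
  classical
  induction s using Finset.induction_on with
  | empty => simp [sum_powersetCard_succ_empty_prod]
  | insert x s hx ih =>
    simp only [sum_powersetCard_insert_prod hx 2, sum_powersetCard_insert_prod hx 1,
      sum_powersetCard_insert_prod hx 0, sum_powersetCard_two_prod_add, ih,
      Finset.card_insert_of_notMem hx, zero_add,
      Finset.powersetCard_zero, Finset.sum_singleton, Finset.prod_empty]
    push_cast
    ring

/-- With `a = (12/(n(n-1)(n-2)))^{1/3}` and `C₀ = (n-2)a/2`, one has the identity
`σ₃(μ + a𝟙) - C₀σ₂(μ + a𝟙) = σ₃(μ) + ((n-2)a/2) σ₂(μ) - 1` for every `μ ∈ ℝⁿ`. -/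
theorem shift_identity_quotient_l_eq_two
    (n : ℕ) (hn : 3 ≤ n) (a C₀ : ℝ)
    (ha : a = (12 / ((n : ℝ) * ((n : ℝ) - 1) * ((n : ℝ) - 2))) ^ ((1 : ℝ) / 3))
    (hC₀ : C₀ = ((n : ℝ) - 2) * a / 2) :
    ∀ μ : Fin n → ℝ,
      esymm n 3 (fun i => μ i + a) - C₀ * esymm n 2 (fun i => μ i + a) =
        esymm n 3 μ + (((n : ℝ) - 2) * a / 2) * esymm n 2 μ - 1 := by
  intro μ
  have hn' : (3 : ℝ) ≤ n := by exact_mod_cast hn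
  have hpos : 0 < (n : ℝ) * ((n : ℝ) - 1) * ((n : ℝ) - 2) :=
    mul_pos (mul_pos (by linarith) (by linarith)) (by linarith)
  have ha3 : a ^ 3 = 12 / ((n : ℝ) * ((n : ℝ) - 1) * ((n : ℝ) - 2)) := by
    rw [ha, ← Real.rpow_natCast, ← Real.rpow_mul (div_pos (by norm_num) hpos).le]
    norm_num
  have hcube : (n : ℝ) * ((n : ℝ) - 1) * ((n : ℝ) - 2) * a ^ 3 = 12 := by
    rw [ha3, mul_div_cancel₀ _ hpos.ne']
  simp only [esymm, sum_powersetCard_three_prod_add, sum_powersetCard_two_prod_add,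
    Finset.card_univ, Fintype.card_fin, hC₀]
  linear_combination (-1 / 12 : ℝ) * hcube
end
end
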